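/- Every nonzero invariant homogeneous polynomial of degree 8 in the polynomial ring ℂ[x_{ijk}] with variables indexed by (i,j,k) ∈ {1,2,3,4} × {1,2,3,4} × {1,2} has exactly 14148 monomials in its support, and the set of its nonzero coefficients has exactly 13 distinct elements. -/

import Mathlib

open MvPolynomial

/-- The derivation `D_{A,B,C}` of `ℂ[x_{ijk}]` (format `4 × 4 × 2`) determined on variables by
`D(x_{ijk}) = Σ_{i'} A_{i'i} x_{i'jk} + Σ_{j'} B_{j'j} x_{ij'k} + Σ_{k'} C_{k'k} x_{ijk'}`. -/
noncomputable def liederiv (A : Matrix (Fin 4) (Fin 4) ℂ) (B : Matrix (Fin 4) (Fin 4) ℂ)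
    (C : Matrix (Fin 2) (Fin 2) ℂ) :
    Derivation ℂ (MvPolynomial (Fin 4 × Fin 4 × Fin 2) ℂ)
      (MvPolynomial (Fin 4 × Fin 4 × Fin 2) ℂ) :=
  mkDerivation ℂ fun v =>
    (∑ i' : Fin 4, A i' v.1 • X (i', v.2.1, v.2.2)) +
    (∑ j' : Fin 4, B j' v.2.1 • X (v.1, j', v.2.2)) +
    (∑ k' : Fin 2, C k' v.2.2 • X (v.1, v.2.1, k'))

/-- A polynomial is invariant if it is annihilated by every derivation `D_{A,B,C}` with
`A`, `B`, `C` traceless. -/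
def InvariantPoly (f : MvPolynomial (Fin 4 × Fin 4 × Fin 2) ℂ) : Prop :=
  ∀ (A : Matrix (Fin 4) (Fin 4) ℂ) (B : Matrix (Fin 4) (Fin 4) ℂ)
    (C : Matrix (Fin 2) (Fin 2) ℂ), A.trace = 0 → B.trace = 0 → C.trace = 0 →
      liederiv A B C f = 0

/-- The array whose two slices are the matrices `P` and `Q`. -/
def ofSlices (P Q : Matrix (Fin 4) (Fin 4) ℂ) : Fin 4 × Fin 4 × Fin 2 → ℂ :=
  fun v => (![P, Q] v.2.2) v.1 v.2.1

theorem ofSlices_surjective (x : Fin 4 × Fin 4 × Fin 2 → ℂ) :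
    ∃ P Q, ofSlices P Q = x := by
  refine ⟨Matrix.of fun i j => x (i, j, 0), Matrix.of fun i j => x (i, j, 1), ?_⟩
  funext ⟨i, j, k⟩
  fin_cases k <;> rfl

/-- If the derivation `X v ↦ L v` kills `f`, then `f` is unchanged along a segment on which the
vector field `L` is constant and equal to the direction of the segment. -/
theorem eval_add_eq_of_mkDerivation_eq_zero {σ : Type*} {L : σ → MvPolynomial σ ℂ}
    {f : MvPolynomial σ ℂ} (hf : mkDerivation ℂ L f = 0) {x y : σ → ℂ}
    (h : ∀ (t : ℂ) (v : σ), eval (fun w => x w + t * y w) (L v) = y v) :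
    eval (fun w => x w + y w) f = eval x f := by
  let g : σ → Polynomial ℂ := fun w => Polynomial.C (x w) + Polynomial.X * Polynomial.C (y w)
  have eval_g : ∀ (t : ℂ) (p : MvPolynomial σ ℂ),
      (aeval g p).eval t = eval (fun w => x w + t * y w) p := by
    intro t p
    induction p using MvPolynomial.induction_on with
    | C a => simp [Polynomial.algebraMap_eq]
    | add p q hp hq => simp [hp, hq]
    | mul_X p v hp =>
      have hv : (g v).eval t = x v + t * y v := by
        simp only [g, Polynomial.eval_add, Polynomial.eval_mul, Polynomial.eval_C,
          Polynomial.eval_X]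
      rw [map_mul, Polynomial.eval_mul, hp, map_mul, aeval_X, eval_X, hv]
  have hL : ∀ v, aeval g (L v) = Polynomial.C (y v) := fun v =>
    Polynomial.funext fun t => by rw [eval_g, h]; simp
  have hD : ∀ p, Polynomial.derivative (aeval g p) = aeval g (mkDerivation ℂ L p) := by
    intro p
    induction p using MvPolynomial.induction_on with
    | C a => simp [Polynomial.algebraMap_eq]
    | add p q hp hq => simp [hp, hq]
    | mul_X p v hp =>
      have hv : Polynomial.derivative (g v) = Polynomial.C (y v) := by simp [g]
      rw [map_mul, Polynomial.derivative_mul, hp, aeval_X, hv, Derivation.leibniz,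
        mkDerivation_X, smul_eq_mul, smul_eq_mul, map_add (aeval g), map_mul, map_mul, hL, aeval_X]
      ring
  have hconst := Polynomial.eq_C_of_derivative_eq_zero ((hD f).trans (by rw [hf, map_zero]))
  have h1 := eval_g 1 f
  have h0 := eval_g 0 f
  rw [hconst] at h1 h0
  simp only [Polynomial.eval_C, one_mul, zero_mul, add_zero] at h1 h0
  rw [← h1, h0]

/-- The vector field of the Lie algebra action, evaluated at an array. -/
theorem eval_liederiv_X (A B : Matrix (Fin 4) (Fin 4) ℂ) (C : Matrix (Fin 2) (Fin 2) ℂ)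
    (P Q : Matrix (Fin 4) (Fin 4) ℂ) (v : Fin 4 × Fin 4 × Fin 2) :
    eval (ofSlices P Q) (liederiv A B C (X v)) =
      ofSlices (A.transpose * P + P * B + C 0 0 • P + C 1 0 • Q)
        (A.transpose * Q + Q * B + C 0 1 • P + C 1 1 • Q) v := by
  obtain ⟨i, j, k⟩ := v
  fin_cases k <;>
    simp [liederiv, mkDerivation_X, ofSlices, Matrix.mul_apply, smul_eval, mul_comm, add_assoc]

theorem InvariantPoly.eval_add {f : MvPolynomial (Fin 4 × Fin 4 × Fin 2) ℂ}
    (hf : InvariantPoly f) {A B : Matrix (Fin 4) (Fin 4) ℂ} {C : Matrix (Fin 2) (Fin 2) ℂ}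
    (hA : A.trace = 0) (hB : B.trace = 0) (hC : C.trace = 0)
    (P Q P' Q' : Matrix (Fin 4) (Fin 4) ℂ)
    (hP : ∀ t : ℂ, A.transpose * (P + t • P') + (P + t • P') * B + C 0 0 • (P + t • P')
      + C 1 0 • (Q + t • Q') = P')
    (hQ : ∀ t : ℂ, A.transpose * (Q + t • Q') + (Q + t • Q') * B + C 0 1 • (P + t • P')
      + C 1 1 • (Q + t • Q') = Q') :
    eval (ofSlices (P + P') (Q + Q')) f = eval (ofSlices P Q) f := by
  have hadd : ∀ t : ℂ, (fun w => ofSlices P Q w + t * ofSlices P' Q' w) =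
      ofSlices (P + t • P') (Q + t • Q') := by
    intro t
    funext ⟨i, j, k⟩
    fin_cases k <;> simp [ofSlices]
  have key := eval_add_eq_of_mkDerivation_eq_zero (x := ofSlices P Q) (y := ofSlices P' Q')
    (hf A B C hA hB hC) (by
      intro t v
      rw [hadd t]
      have := eval_liederiv_X A B C (P + t • P') (Q + t • Q') v
      rw [hP t, hQ t, liederiv, mkDerivation_X] at this
      exact this)
  have h1 := hadd 1
  simp only [one_mul, one_smul] at h1
  rw [← h1, key]

theorem single_mul_self_of_ne {i j : Fin 4} (h : i ≠ j) (c : ℂ) :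
    Matrix.single i j c * Matrix.single i j c = 0 :=
  Matrix.single_mul_single_of_ne _ _ _ _ h.symm _

theorem InvariantPoly.eval_transvection_mul {f : MvPolynomial (Fin 4 × Fin 4 × Fin 2) ℂ}
    (hf : InvariantPoly f) {i j : Fin 4} (hij : i ≠ j) (c : ℂ)
    (P Q : Matrix (Fin 4) (Fin 4) ℂ) :
    eval (ofSlices (Matrix.transvection i j c * P) (Matrix.transvection i j c * Q)) f =
      eval (ofSlices P Q) f := by
  have key := hf.eval_add (A := Matrix.single j i c) (B := 0) (C := 0)
    (by simp [Matrix.trace_single_eq_of_ne, hij.symm]) (by simp) (by simp) P Q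
    (Matrix.single i j c * P) (Matrix.single i j c * Q)
    (by intro t; simp [mul_add, ← mul_assoc, single_mul_self_of_ne hij])
    (by intro t; simp [mul_add, ← mul_assoc, single_mul_self_of_ne hij])
  simpa [Matrix.transvection, add_mul] using key

theorem InvariantPoly.eval_mul_transvection {f : MvPolynomial (Fin 4 × Fin 4 × Fin 2) ℂ}
    (hf : InvariantPoly f) {i j : Fin 4} (hij : i ≠ j) (c : ℂ)
    (P Q : Matrix (Fin 4) (Fin 4) ℂ) :
    eval (ofSlices (P * Matrix.transvection i j c) (Q * Matrix.transvection i j c)) f =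
      eval (ofSlices P Q) f := by
  have key := hf.eval_add (A := 0) (B := Matrix.single i j c) (C := 0)
    (by simp) (by simp [Matrix.trace_single_eq_of_ne, hij]) (by simp) P Q
    (P * Matrix.single i j c) (Q * Matrix.single i j c)
    (by intro t; simp [add_mul, mul_assoc, single_mul_self_of_ne hij])
    (by intro t; simp [add_mul, mul_assoc, single_mul_self_of_ne hij])
  simpa [Matrix.transvection, mul_add] using key

theorem InvariantPoly.eval_add_smul {f : MvPolynomial (Fin 4 × Fin 4 × Fin 2) ℂ}
    (hf : InvariantPoly f) (c : ℂ) (P Q : Matrix (Fin 4) (Fin 4) ℂ) :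
    eval (ofSlices (P + c • Q) Q) f = eval (ofSlices P Q) f := by
  have key := hf.eval_add (A := 0) (B := 0) (C := Matrix.single 1 0 c)
    (by simp) (by simp) (by simp [Matrix.trace_single_eq_of_ne]) P Q (c • Q) 0
    (by intro t; simp) (by intro t; simp)
  simpa using key

/-- A diagonal derivation multiplies every coefficient by its weight. -/
theorem coeff_mkDerivation_smul_X {σ : Type*} [Fintype σ] (ω : σ → ℂ) (f : MvPolynomial σ ℂ)
    (d : σ →₀ ℕ) :
    coeff d (mkDerivation ℂ (fun v => ω v • (X v : MvPolynomial σ ℂ)) f) =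
      (∑ v, (d v : ℂ) * ω v) * coeff d f := by
  classical
  have hmon : ∀ (e : σ →₀ ℕ) (a : ℂ),
      mkDerivation ℂ (fun v => ω v • (X v : MvPolynomial σ ℂ)) (monomial e a) =
        (∑ v, (e v : ℂ) * ω v) • monomial e a := by
    intro e a
    rw [mkDerivation_monomial, Finsupp.sum_fintype _ _ (by simp), Finset.smul_sum, Finset.sum_smul]
    refine Finset.sum_congr rfl fun v _ => ?_
    rcases Nat.eq_zero_or_pos (e v) with h0 | h0
    · simp [h0]
    · have hle : Finsupp.single v 1 ≤ e := by
        rw [Finsupp.single_le_iff]; exact h0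
      rw [smul_eq_mul, mul_smul_comm, X, monomial_mul, tsub_add_cancel_of_le hle, smul_monomial,
        smul_monomial, smul_monomial]
      congr 1
      simp only [smul_eq_mul]
      ring
  induction f using MvPolynomial.induction_on' with
  | monomial e a =>
    rw [hmon, coeff_smul, coeff_monomial]
    split_ifs with h
    · rw [h, smul_eq_mul]
    · simp
  | add p q hp hq => rw [map_add, coeff_add, hp, hq, coeff_add, mul_add]

theorem InvariantPoly.weight_eq_zero {f : MvPolynomial (Fin 4 × Fin 4 × Fin 2) ℂ}
    (hf : InvariantPoly f) {d : Fin 4 × Fin 4 × Fin 2 →₀ ℕ} (hd : coeff d f ≠ 0)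
    (a b : Fin 4 → ℂ) (c : Fin 2 → ℂ) (ha : ∑ i, a i = 0) (hb : ∑ i, b i = 0)
    (hc : ∑ i, c i = 0) : ∑ v, (d v : ℂ) * (a v.1 + b v.2.1 + c v.2.2) = 0 := by
  have h := hf (Matrix.diagonal a) (Matrix.diagonal b) (Matrix.diagonal c)
    (by rw [Matrix.trace_diagonal, ha]) (by rw [Matrix.trace_diagonal, hb])
    (by rw [Matrix.trace_diagonal, hc])
  have hL : liederiv (Matrix.diagonal a) (Matrix.diagonal b) (Matrix.diagonal c) =
      mkDerivation ℂ fun v : Fin 4 × Fin 4 × Fin 2 =>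
        (a v.1 + b v.2.1 + c v.2.2) • (X v : MvPolynomial (Fin 4 × Fin 4 × Fin 2) ℂ) := by
    rw [liederiv]
    congr 1
    funext ⟨i, j, k⟩
    simp [Matrix.diagonal_apply, ite_smul, add_smul]
  have h2 := congrArg (coeff d) h
  rw [hL, coeff_mkDerivation_smul_X, coeff_zero] at h2
  exact (mul_eq_zero.mp h2).resolve_right hd

/-- A functional vanishing on all vectors of coordinate sum zero has constant coefficients. -/
theorem eq_of_forall_sum_eq_zero {ι : Type*} [Fintype ι] [DecidableEq ι] {r : ι → ℕ}
    (h : ∀ a : ι → ℂ, ∑ i, a i = 0 → ∑ i, (r i : ℂ) * a i = 0) (i j : ι) : r i = r j := by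
  have := h (fun l => (if l = i then 1 else 0) - if l = j then 1 else 0) (by simp)
  simp only [mul_sub, Finset.sum_sub_distrib, mul_ite, mul_one, mul_zero, Finset.sum_ite_eq',
    Finset.mem_univ, if_true] at this
  exact_mod_cast sub_eq_zero.mp this

theorem InvariantPoly.sum_row {f : MvPolynomial (Fin 4 × Fin 4 × Fin 2) ℂ}
    (hf : InvariantPoly f) (hhom : f.IsHomogeneous 8) {d : Fin 4 × Fin 4 × Fin 2 →₀ ℕ}
    (hd : coeff d f ≠ 0) (i : Fin 4) : ∑ j, ∑ k, d (i, j, k) = 2 := by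
  have h := eq_of_forall_sum_eq_zero (r := fun i => ∑ j, ∑ k, d (i, j, k)) (fun a ha => by
    have := hf.weight_eq_zero hd a 0 0 ha (by simp) (by simp)
    simpa [Fintype.sum_prod_type, Finset.sum_mul, add_mul] using this)
  have hdeg : ∑ v, d v = 8 := by
    rw [← Finsupp.degree_eq_sum, Finsupp.degree_eq_weight_one]; exact hhom hd
  rw [Fintype.sum_prod_type] at hdeg
  simp only [Fintype.sum_prod_type (α₁ := Fin 4) (α₂ := Fin 2)] at hdeg
  rw [Finset.sum_congr rfl fun l _ => h l i, Finset.sum_const, Finset.card_univ,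
    Fintype.card_fin, smul_eq_mul] at hdeg
  omega

theorem InvariantPoly.sum_col {f : MvPolynomial (Fin 4 × Fin 4 × Fin 2) ℂ}
    (hf : InvariantPoly f) (hhom : f.IsHomogeneous 8) {d : Fin 4 × Fin 4 × Fin 2 →₀ ℕ}
    (hd : coeff d f ≠ 0) (j : Fin 4) : ∑ i, ∑ k, d (i, j, k) = 2 := by
  have h := eq_of_forall_sum_eq_zero (r := fun j => ∑ i, ∑ k, d (i, j, k)) (fun a ha => by
    have := hf.weight_eq_zero hd 0 a 0 (by simp) ha (by simp)
    rw [Fintype.sum_prod_type] at this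
    simp only [Fintype.sum_prod_type (α₁ := Fin 4) (α₂ := Fin 2)] at this
    rw [Finset.sum_comm] at this
    simpa [Finset.sum_mul, add_mul] using this)
  have hdeg : ∑ v, d v = 8 := by
    rw [← Finsupp.degree_eq_sum, Finsupp.degree_eq_weight_one]; exact hhom hd
  rw [Fintype.sum_prod_type] at hdeg
  simp only [Fintype.sum_prod_type (α₁ := Fin 4) (α₂ := Fin 2)] at hdeg
  rw [Finset.sum_comm, Finset.sum_congr rfl fun l _ => h l j, Finset.sum_const, Finset.card_univ,
    Fintype.card_fin, smul_eq_mul] at hdeg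
  omega

theorem InvariantPoly.sum_slice {f : MvPolynomial (Fin 4 × Fin 4 × Fin 2) ℂ}
    (hf : InvariantPoly f) (hhom : f.IsHomogeneous 8) {d : Fin 4 × Fin 4 × Fin 2 →₀ ℕ}
    (hd : coeff d f ≠ 0) (k : Fin 2) : ∑ i, ∑ j, d (i, j, k) = 4 := by
  have h := eq_of_forall_sum_eq_zero (r := fun k => ∑ i, ∑ j, d (i, j, k)) (fun a ha => by
    have := hf.weight_eq_zero hd 0 0 a (by simp) (by simp) ha
    simp only [Fintype.sum_prod_type] at this
    simp only [Finset.sum_comm (s := (Finset.univ : Finset (Fin 4)))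
      (t := (Finset.univ : Finset (Fin 2)))] at this
    simpa [Finset.sum_mul, add_mul] using this)
  have hdeg : ∑ v, d v = 8 := by
    rw [← Finsupp.degree_eq_sum, Finsupp.degree_eq_weight_one]; exact hhom hd
  simp only [Fintype.sum_prod_type] at hdeg
  simp only [Finset.sum_comm (s := (Finset.univ : Finset (Fin 4)))
      (t := (Finset.univ : Finset (Fin 2)))] at hdeg
  rw [Finset.sum_congr rfl fun l _ => h l k, Finset.sum_const, Finset.card_univ,
    Fintype.card_fin, smul_eq_mul] at hdeg
  omega

theorem InvariantPoly.eval_ofSlices_mul_left {f : MvPolynomial (Fin 4 × Fin 4 × Fin 2) ℂ}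
    (hf : InvariantPoly f) (hhom : f.IsHomogeneous 8) {g : Matrix (Fin 4) (Fin 4) ℂ}
    (hg : g.det ≠ 0) (P Q : Matrix (Fin 4) (Fin 4) ℂ) :
    eval (ofSlices (g * P) (g * Q)) f = g.det ^ 2 * eval (ofSlices P Q) f := by
  refine Matrix.diagonal_transvection_induction_of_det_ne_zero
    (fun g => ∀ P Q : Matrix (Fin 4) (Fin 4) ℂ,
      eval (ofSlices (g * P) (g * Q)) f = g.det ^ 2 * eval (ofSlices P Q) f) g hg ?_ ?_ ?_ P Q
  · intro D _ P Q
    rw [eval_eq', eval_eq', Finset.mul_sum]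
    refine Finset.sum_congr rfl fun d hd => ?_
    rw [mul_left_comm]
    congr 1
    have hrow := hf.sum_row hhom (mem_support_iff.mp hd)
    have hv : ∀ v, ofSlices (Matrix.diagonal D * P) (Matrix.diagonal D * Q) v ^ d v =
        D v.1 ^ d v * ofSlices P Q v ^ d v := by
      rintro ⟨i, j, k⟩
      rw [← mul_pow]
      fin_cases k <;> simp [ofSlices, Matrix.diagonal_mul]
    rw [Finset.prod_congr rfl fun v _ => hv v, Finset.prod_mul_distrib]
    congr 1
    rw [Matrix.det_diagonal, ← Finset.prod_pow, Fintype.prod_prod_type]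
    refine Finset.prod_congr rfl fun i _ => ?_
    dsimp only
    rw [Finset.prod_pow_eq_pow_sum, Fintype.sum_prod_type, hrow]
  · intro t P Q
    rw [Matrix.TransvectionStruct.det, one_pow, one_mul]
    exact hf.eval_transvection_mul t.hij t.c P Q
  · intro A B _ _ ihA ihB P Q
    rw [Matrix.mul_assoc, Matrix.mul_assoc, ihA, ihB, Matrix.det_mul, mul_pow, mul_assoc]

theorem InvariantPoly.eval_ofSlices_mul_right {f : MvPolynomial (Fin 4 × Fin 4 × Fin 2) ℂ}
    (hf : InvariantPoly f) (hhom : f.IsHomogeneous 8) {g : Matrix (Fin 4) (Fin 4) ℂ}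
    (hg : g.det ≠ 0) (P Q : Matrix (Fin 4) (Fin 4) ℂ) :
    eval (ofSlices (P * g) (Q * g)) f = g.det ^ 2 * eval (ofSlices P Q) f := by
  refine Matrix.diagonal_transvection_induction_of_det_ne_zero
    (fun g => ∀ P Q : Matrix (Fin 4) (Fin 4) ℂ,
      eval (ofSlices (P * g) (Q * g)) f = g.det ^ 2 * eval (ofSlices P Q) f) g hg ?_ ?_ ?_ P Q
  · intro D _ P Q
    rw [eval_eq', eval_eq', Finset.mul_sum]
    refine Finset.sum_congr rfl fun d hd => ?_
    rw [mul_left_comm]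
    congr 1
    have hcol := hf.sum_col hhom (mem_support_iff.mp hd)
    have hv : ∀ v, ofSlices (P * Matrix.diagonal D) (Q * Matrix.diagonal D) v ^ d v =
        D v.2.1 ^ d v * ofSlices P Q v ^ d v := by
      rintro ⟨i, j, k⟩
      rw [← mul_pow]
      fin_cases k <;> simp [ofSlices, Matrix.mul_diagonal, mul_comm]
    rw [Finset.prod_congr rfl fun v _ => hv v, Finset.prod_mul_distrib]
    congr 1
    rw [Matrix.det_diagonal, ← Finset.prod_pow, Fintype.prod_prod_type]
    simp only [Fintype.prod_prod_type (α₁ := Fin 4) (α₂ := Fin 2)]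
    rw [Finset.prod_comm]
    refine Finset.prod_congr rfl fun j _ => ?_
    simp only [Finset.prod_pow_eq_pow_sum]
    rw [hcol]
  · intro t P Q
    rw [Matrix.TransvectionStruct.det, one_pow, one_mul]
    exact hf.eval_mul_transvection t.hij t.c P Q
  · intro A B _ _ ihA ihB P Q
    rw [← Matrix.mul_assoc, ← Matrix.mul_assoc, ihB, ihA, Matrix.det_mul, mul_pow]
    ring

/-- A nonzero vector is the first column of an invertible matrix. -/
theorem exists_det_ne_zero_col_zero {n : ℕ} {v : Fin (n + 1) → ℂ} (hv : v ≠ 0) :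
    ∃ P : Matrix (Fin (n + 1)) (Fin (n + 1)) ℂ, P.det ≠ 0 ∧ ∀ i, P i 0 = v i := by
  obtain ⟨i, hi⟩ := Function.ne_iff.mp hv
  have hdet : ((1 : Matrix (Fin (n + 1)) (Fin (n + 1)) ℂ).updateCol i v).det = v i := by
    rw [← Matrix.cramer_apply, Matrix.cramer_one, Module.End.one_apply]
  refine ⟨((1 : Matrix _ _ ℂ).updateCol i v).submatrix id (Equiv.swap 0 i), ?_, fun j => ?_⟩
  · rw [Matrix.det_permute', hdet]
    exact mul_ne_zero (by simp) hi
  · simp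

/-- Every complex square matrix is similar to an upper triangular one. -/
theorem exists_mul_eq_mul_blockTriangular {n : ℕ} (M : Matrix (Fin n) (Fin n) ℂ) :
    ∃ P U : Matrix (Fin n) (Fin n) ℂ, P.det ≠ 0 ∧ M * P = P * U ∧ U.BlockTriangular id := by
  induction n with
  | zero => exact ⟨1, M, by simp, by simp, fun i => i.elim0⟩
  | succ n ih =>
    obtain ⟨μ, hμ⟩ := IsAlgClosed.exists_root M.charpoly (by
      rw [Matrix.charpoly_degree_eq_dim, Fintype.card_fin]; exact_mod_cast Nat.succ_ne_zero n)
    rw [Polynomial.IsRoot, Matrix.eval_charpoly, ← Matrix.exists_mulVec_eq_zero_iff] at hμ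
    obtain ⟨v, hv, hMv⟩ := hμ
    obtain ⟨P, hP, hPv⟩ := exists_det_ne_zero_col_zero hv
    have hPu : IsUnit P.det := isUnit_iff_ne_zero.mpr hP
    let N := P⁻¹ * M * P
    have hMP : M * P = P * N := by
      simp only [N, ← Matrix.mul_assoc, Matrix.mul_nonsing_inv _ hPu, Matrix.one_mul]
    have hN : ∀ i : Fin n, N i.succ 0 = 0 := by
      intro i
      have hcol : P.col 0 = v := funext hPv
      have hev : M.mulVec v = μ • v := by
        rw [Matrix.sub_mulVec, sub_eq_zero] at hMv
        rw [← hMv]; simp [Matrix.scalar_apply]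
      have h1 : N.col 0 = μ • Pi.single 0 1 := by
        rw [← Matrix.mulVec_single_one, ← Matrix.mulVec_mulVec, ← Matrix.mulVec_mulVec,
          Matrix.mulVec_single_one, hcol, hev, Matrix.mulVec_smul, ← hcol,
          ← Matrix.mulVec_single_one, Matrix.mulVec_mulVec, Matrix.nonsing_inv_mul _ hPu,
          Matrix.one_mulVec]
      have := congrFun h1 i.succ
      simpa using this
    obtain ⟨P', U', hP', hMP', hU'⟩ := ih (N.submatrix Fin.succ Fin.succ)
    let R : Matrix (Fin (n + 1)) (Fin (n + 1)) ℂ :=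
      Matrix.of (Fin.cons (Fin.cons 1 0) fun i => Fin.cons 0 (P' i))
    let U : Matrix (Fin (n + 1)) (Fin (n + 1)) ℂ :=
      Matrix.of (Fin.cons (Fin.cons (N 0 0) fun j => ∑ l, N 0 (Fin.succ l) * P' l j)
        fun i => Fin.cons 0 (U' i))
    have hR : R.det = P'.det := by
      rw [Matrix.det_succ_column_zero, Fin.sum_univ_succ]
      simp [R]
      rfl
    have hNR : N * R = R * U := by
      ext i j
      have h2 := fun i j => congrFun (congrFun hMP' i) j
      simp only [Matrix.mul_apply, Matrix.submatrix_apply] at h2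
      refine Fin.cases ?_ (fun i => ?_) i <;> refine Fin.cases ?_ (fun j => ?_) j <;>
        simp [Matrix.mul_apply, Fin.sum_univ_succ, R, U, hN, h2]
    refine ⟨P * R, U, ?_, ?_, ?_⟩
    · rw [Matrix.det_mul, hR]; exact mul_ne_zero hP hP'
    · rw [← Matrix.mul_assoc, hMP, Matrix.mul_assoc, hNR, Matrix.mul_assoc]
    · intro i j
      refine Fin.cases ?_ (fun i => ?_) i <;> refine Fin.cases ?_ (fun j => ?_) j <;> intro hij
      · exact absurd hij (lt_irrefl _)
      · exact absurd hij (by simp)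
      · simp [U]
      · simpa [U] using hU' (by simpa using hij)

/-- The exponent vectors of the monomials `∏ i, a i ^ (2 - e i) * b i ^ e i` of bidegree
`(4, 4)`. -/
def diagExponents : List (Fin 4 → Fin 3) :=
  [![0, 0, 2, 2], ![0, 1, 1, 2], ![0, 1, 2, 1], ![0, 2, 0, 2], ![0, 2, 1, 1],
    ![0, 2, 2, 0], ![1, 0, 1, 2], ![1, 0, 2, 1], ![1, 1, 0, 2], ![1, 1, 1, 1],
    ![1, 1, 2, 0], ![1, 2, 0, 1], ![1, 2, 1, 0], ![2, 0, 0, 2], ![2, 0, 1, 1],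
    ![2, 0, 2, 0], ![2, 1, 0, 1], ![2, 1, 1, 0], ![2, 2, 0, 0]]

theorem mem_diagExponents : ∀ e : Fin 4 → Fin 3, ∑ i, (e i : ℕ) = 4 → e ∈ diagExponents := by
  decide

theorem nodup_diagExponents : diagExponents.Nodup := by
  decide

/-- The exponent vector of the monomial `∏ i, x (i, i, 0) ^ (2 - e i) * x (i, i, 1) ^ e i`. -/
noncomputable def diagMonomial (e : Fin 4 → Fin 3) : Fin 4 × Fin 4 × Fin 2 →₀ ℕ :=
  Finsupp.equivFunOnFinite.symm fun v =>
    if v.1 = v.2.1 then ![2 - (e v.1 : ℕ), (e v.1 : ℕ)] v.2.2 else 0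

theorem diagMonomial_apply (e : Fin 4 → Fin 3) (i j : Fin 4) (k : Fin 2) :
    diagMonomial e (i, j, k) = if i = j then ![2 - (e i : ℕ), (e i : ℕ)] k else 0 := rfl

theorem diagMonomial_injective : Function.Injective diagMonomial := by
  intro e e' h
  funext i
  have := DFunLike.congr_fun h (i, i, 1)
  simpa [diagMonomial_apply, Fin.ext_iff] using this

theorem prod_pow_diagMonomial (e : Fin 4 → Fin 3) (x : Fin 4 × Fin 4 × Fin 2 → ℂ) :
    ∏ v, x v ^ diagMonomial e v =
      ∏ i, x (i, i, 0) ^ (2 - (e i : ℕ)) * x (i, i, 1) ^ (e i : ℕ) := by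
  rw [Fintype.prod_prod_type]
  refine Finset.prod_congr rfl fun i _ => ?_
  rw [Fintype.prod_prod_type, Finset.prod_eq_single i]
  · simp [diagMonomial_apply, Fin.prod_univ_two]
  · intro j _ hj
    simp [diagMonomial_apply, hj.symm]
  · simp

/-- An upper triangular matrix of natural numbers with all row and column sums equal to `2` is
twice the identity matrix. -/
theorem eq_two_mul_one_of_upperTriangular {D : Fin 4 → Fin 4 → ℕ} (hrow : ∀ i, ∑ j, D i j = 2)
    (hcol : ∀ j, ∑ i, D i j = 2) (hD : ∀ i j, j < i → D i j = 0) (i j : Fin 4) :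
    D i j = if i = j then 2 else 0 := by
  simp only [Fin.sum_univ_four] at hrow hcol
  have r0 := hrow 0
  have r1 := hrow 1
  have r2 := hrow 2
  have c0 := hcol 0
  have c1 := hcol 1
  have c2 := hcol 2
  have c3 := hcol 3
  have h10 := hD 1 0 (by decide)
  have h20 := hD 2 0 (by decide)
  have h30 := hD 3 0 (by decide)
  have h21 := hD 2 1 (by decide)
  have h31 := hD 3 1 (by decide)
  have h32 := hD 3 2 (by decide)
  fin_cases i <;> fin_cases j <;> simp <;> omega

/-- An exponent vector of zero weight which is supported on the upper triangle is supported on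
the diagonal. -/
theorem exists_eq_diagMonomial {d : Fin 4 × Fin 4 × Fin 2 →₀ ℕ}
    (hrow : ∀ i, ∑ j, ∑ k, d (i, j, k) = 2) (hcol : ∀ j, ∑ i, ∑ k, d (i, j, k) = 2)
    (hslice : ∀ k, ∑ i, ∑ j, d (i, j, k) = 4) (hd : ∀ i j k, j < i → d (i, j, k) = 0) :
    ∃ e ∈ diagExponents, d = diagMonomial e := by
  have hD := eq_two_mul_one_of_upperTriangular (D := fun i j => ∑ k, d (i, j, k)) hrow hcol
    fun i j hij => Finset.sum_eq_zero fun k _ => hd i j k hij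
  simp only [Fin.sum_univ_two] at hD
  have hdiag : ∀ i, d (i, i, 0) + d (i, i, 1) = 2 ∧ ∀ j k, i ≠ j → d (i, j, k) = 0 := by
    refine fun i => ⟨by simp [hD i i], fun j k hij => ?_⟩
    have := hD i j
    rw [if_neg hij] at this
    fin_cases k <;> simp <;> omega
  have hle : ∀ i, d (i, i, 1) < 3 := fun i => by have := (hdiag i).1; omega
  refine ⟨fun i => ⟨d (i, i, 1), hle i⟩, mem_diagExponents _ ?_, ?_⟩
  · refine Eq.trans (Finset.sum_congr rfl fun i _ => ?_) (hslice 1)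
    rw [Finset.sum_eq_single i]
    · intro j _ hj
      exact (hdiag i).2 j 1 hj.symm
    · simp
  · ext ⟨i, j, k⟩
    rw [diagMonomial_apply]
    split_ifs with hij
    · subst hij
      have := (hdiag i).1
      fin_cases k
      · simp; omega
      · simp
    · exact (hdiag i).2 j k hij

theorem InvariantPoly.eval_ofSlices_of_upperTriangular
    {f : MvPolynomial (Fin 4 × Fin 4 × Fin 2) ℂ} (hf : InvariantPoly f)
    (hhom : f.IsHomogeneous 8) {P Q : Matrix (Fin 4) (Fin 4) ℂ}
    (hP : P.BlockTriangular id) (hQ : Q.BlockTriangular id) :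
    eval (ofSlices P Q) f = (diagExponents.map fun e => coeff (diagMonomial e) f *
      ∏ i, P i i ^ (2 - (e i : ℕ)) * Q i i ^ (e i : ℕ)).sum := by
  classical
  rw [← List.sum_toFinset _ nodup_diagExponents, eval_eq']
  have himage := Finset.sum_image (s := diagExponents.toFinset) (g := diagMonomial)
    (f := fun d => coeff d f * ∏ v, ofSlices P Q v ^ d v) diagMonomial_injective.injOn
  have hterm : ∀ e, coeff (diagMonomial e) f * ∏ v, ofSlices P Q v ^ diagMonomial e v =
      coeff (diagMonomial e) f * ∏ i, P i i ^ (2 - (e i : ℕ)) * Q i i ^ (e i : ℕ) := by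
    intro e
    rw [prod_pow_diagMonomial]
    rfl
  rw [Finset.sum_congr rfl fun e _ => (hterm e).symm, ← himage]
  refine Finset.sum_congr_of_eq_on_inter ?_ ?_ fun _ _ _ => rfl
  · intro d hd hd'
    have hd := mem_support_iff.mp hd
    have hlow : ¬ ∀ i j k, j < i → d (i, j, k) = 0 := fun hlow => hd' <| by
      obtain ⟨e, he, rfl⟩ := exists_eq_diagMonomial (hf.sum_row hhom hd) (hf.sum_col hhom hd)
        (hf.sum_slice hhom hd) hlow
      exact Finset.mem_image_of_mem _ (List.mem_toFinset.mpr he)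
    push Not at hlow
    obtain ⟨i, j, k, hij, hne⟩ := hlow
    rw [Finset.prod_eq_zero (Finset.mem_univ (i, j, k)), mul_zero]
    have : ofSlices P Q (i, j, k) = 0 := by
      fin_cases k
      · exact hP hij
      · exact hQ hij
    rw [this, zero_pow hne]
  · intro d _ hd
    rw [notMem_support_iff.mp hd, zero_mul]

theorem InvariantPoly.eval_ofSlices_diagonal_comp_perm
    {f : MvPolynomial (Fin 4 × Fin 4 × Fin 2) ℂ} (hf : InvariantPoly f)
    (hhom : f.IsHomogeneous 8) (π : Equiv.Perm (Fin 4)) (a b : Fin 4 → ℂ) :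
    eval (ofSlices (Matrix.diagonal (a ∘ π)) (Matrix.diagonal (b ∘ π))) f =
      eval (ofSlices (Matrix.diagonal a) (Matrix.diagonal b)) f := by
  let g : Matrix (Fin 4) (Fin 4) ℂ := (1 : Matrix (Fin 4) (Fin 4) ℂ).submatrix π id
  have hg : g.det = ((Equiv.Perm.sign π : ℤ) : ℂ) := by
    rw [Matrix.det_permute, Matrix.det_one, mul_one]
  have hg2 : g.det ^ 2 = 1 := by
    rw [hg, ← Int.cast_pow, ← Units.val_pow_eq_pow_val, Int.units_sq]; simp
  have hg0 : g.det ≠ 0 := fun h => by simp [h] at hg2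
  have hconj : ∀ c : Fin 4 → ℂ, g * Matrix.diagonal c * g.transpose = Matrix.diagonal (c ∘ π) := by
    intro c
    ext i j
    by_cases hij : i = j <;>
      simp [g, Matrix.mul_apply, Matrix.one_apply, Matrix.diagonal_apply, hij]
  rw [← hconj, ← hconj, hf.eval_ofSlices_mul_right hhom (by rwa [Matrix.det_transpose]),
    hf.eval_ofSlices_mul_left hhom hg0, Matrix.det_transpose, hg2, one_mul, one_mul]

/-- On pairs of diagonal matrices, an invariant of degree eight is determined by one of its
coefficients. -/
theorem InvariantPoly.eval_ofSlices_one_diagonal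
    {f : MvPolynomial (Fin 4 × Fin 4 × Fin 2) ℂ} (hf : InvariantPoly f)
    (hhom : f.IsHomogeneous 8) (u : Fin 4 → ℂ) :
    eval (ofSlices 1 (Matrix.diagonal u)) f = coeff (diagMonomial ![2, 2, 0, 0]) f *
      ((u 0 ^ 2 * u 1 ^ 2 + u 0 ^ 2 * u 2 ^ 2 + u 0 ^ 2 * u 3 ^ 2 + u 1 ^ 2 * u 2 ^ 2
          + u 1 ^ 2 * u 3 ^ 2 + u 2 ^ 2 * u 3 ^ 2)
        - u 0 * u 1 * u 2 * (u 0 + u 1 + u 2) - u 0 * u 1 * u 3 * (u 0 + u 1 + u 3)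
        - u 0 * u 2 * u 3 * (u 0 + u 2 + u 3) - u 1 * u 2 * u 3 * (u 1 + u 2 + u 3)
        + 6 * (u 0 * u 1 * u 2 * u 3)) := by
  obtain ⟨γ, hγ⟩ : ∃ γ : (Fin 4 → Fin 3) → ℂ, ∀ e, coeff (diagMonomial e) f = γ e :=
    ⟨_, fun _ => rfl⟩
  have heval : ∀ a b : Fin 4 → ℂ, eval (ofSlices (Matrix.diagonal a) (Matrix.diagonal b)) f =
      γ ![0, 0, 2, 2] * (a 0 ^ 2 * a 1 ^ 2 * b 2 ^ 2 * b 3 ^ 2) +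
        γ ![0, 1, 1, 2] * (a 0 ^ 2 * a 1 * b 1 * a 2 * b 2 * b 3 ^ 2) +
        γ ![0, 1, 2, 1] * (a 0 ^ 2 * a 1 * b 1 * b 2 ^ 2 * a 3 * b 3) +
        γ ![0, 2, 0, 2] * (a 0 ^ 2 * b 1 ^ 2 * a 2 ^ 2 * b 3 ^ 2) +
        γ ![0, 2, 1, 1] * (a 0 ^ 2 * b 1 ^ 2 * a 2 * b 2 * a 3 * b 3) +
        γ ![0, 2, 2, 0] * (a 0 ^ 2 * b 1 ^ 2 * b 2 ^ 2 * a 3 ^ 2) +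
        γ ![1, 0, 1, 2] * (a 0 * b 0 * a 1 ^ 2 * a 2 * b 2 * b 3 ^ 2) +
        γ ![1, 0, 2, 1] * (a 0 * b 0 * a 1 ^ 2 * b 2 ^ 2 * a 3 * b 3) +
        γ ![1, 1, 0, 2] * (a 0 * b 0 * a 1 * b 1 * a 2 ^ 2 * b 3 ^ 2) +
        γ ![1, 1, 1, 1] * (a 0 * b 0 * a 1 * b 1 * a 2 * b 2 * a 3 * b 3) +
        γ ![1, 1, 2, 0] * (a 0 * b 0 * a 1 * b 1 * b 2 ^ 2 * a 3 ^ 2) +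
        γ ![1, 2, 0, 1] * (a 0 * b 0 * b 1 ^ 2 * a 2 ^ 2 * a 3 * b 3) +
        γ ![1, 2, 1, 0] * (a 0 * b 0 * b 1 ^ 2 * a 2 * b 2 * a 3 ^ 2) +
        γ ![2, 0, 0, 2] * (b 0 ^ 2 * a 1 ^ 2 * a 2 ^ 2 * b 3 ^ 2) +
        γ ![2, 0, 1, 1] * (b 0 ^ 2 * a 1 ^ 2 * a 2 * b 2 * a 3 * b 3) +
        γ ![2, 0, 2, 0] * (b 0 ^ 2 * a 1 ^ 2 * b 2 ^ 2 * a 3 ^ 2) +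
        γ ![2, 1, 0, 1] * (b 0 ^ 2 * a 1 * b 1 * a 2 ^ 2 * a 3 * b 3) +
        γ ![2, 1, 1, 0] * (b 0 ^ 2 * a 1 * b 1 * a 2 * b 2 * a 3 ^ 2) +
        γ ![2, 2, 0, 0] * (b 0 ^ 2 * b 1 ^ 2 * a 2 ^ 2 * a 3 ^ 2) := by
    intro a b
    rw [hf.eval_ofSlices_of_upperTriangular hhom (Matrix.blockTriangular_diagonal _)
      (Matrix.blockTriangular_diagonal _)]
    simp only [hγ, diagExponents, List.map_cons, List.map_nil, List.sum_cons, List.sum_nil,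
      Fin.prod_univ_four, Matrix.diagonal_apply_eq]
    simp
    ring
  have hperm : ∀ (i j : Fin 4) (u : Fin 4 → ℂ),
      eval (ofSlices (Matrix.diagonal 1) (Matrix.diagonal (u ∘ Equiv.swap i j))) f =
        eval (ofSlices (Matrix.diagonal 1) (Matrix.diagonal u)) f := fun i j u =>
    hf.eval_ofSlices_diagonal_comp_perm hhom (Equiv.swap i j) 1 u
  have hshift : ∀ u : Fin 4 → ℂ,
      eval (ofSlices (Matrix.diagonal (1 - u)) (Matrix.diagonal u)) f =
        eval (ofSlices (Matrix.diagonal 1) (Matrix.diagonal u)) f := by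
    intro u
    rw [← hf.eval_add_smul (-1) (Matrix.diagonal 1)]
    congr 3
    ext i j
    by_cases hij : i = j <;> simp [hij, sub_eq_add_neg]
  rw [hγ, ← Matrix.diagonal_one]
  change eval (ofSlices (Matrix.diagonal 1) (Matrix.diagonal u)) f = _
  simp only [heval] at hperm hshift ⊢
  have h02 := hperm 1 2 ![1, 1, 0, 0]
  have h03 := hperm 1 3 ![1, 1, 0, 0]
  have h12 := hperm 0 1 ![1, 0, 1, 0]
  have h13 := hperm 0 1 ![1, 0, 0, 1]
  have h23 := hperm 1 2 ![0, 1, 0, 1]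
  have s0 := hshift ![0, 1, 1, 1]
  have p0 := hperm 1 2 ![0, 2, 1, 1]
  have q0 := hperm 1 3 ![0, 2, 1, 1]
  have s1 := hshift ![1, 0, 1, 1]
  have p1 := hperm 0 2 ![2, 0, 1, 1]
  have q1 := hperm 0 3 ![2, 0, 1, 1]
  have s2 := hshift ![1, 1, 0, 1]
  have p2 := hperm 0 1 ![2, 1, 0, 1]
  have q2 := hperm 0 3 ![2, 1, 0, 1]
  have s3 := hshift ![1, 1, 1, 0]
  have p3 := hperm 0 1 ![2, 1, 1, 0]
  have q3 := hperm 0 2 ![2, 1, 1, 0]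
  have s := hshift ![1, 1, 1, 1]
  simp [Equiv.swap_apply_def] at h02 h03 h12 h13 h23 s0 p0 q0 s1 p1 q1 s2 p2 q2 s3 p3 q3 s
  have key : ∀ α x y z : ℂ,
      α * 2 ^ 2 + x * 2 + y * 2 ^ 2 + α + z * 2 = α + x * 2 + y * 2 + α * 2 ^ 2 + z * 2 ^ 2 →
      α * 2 ^ 2 + x * 2 ^ 2 + y * 2 + α * 2 ^ 2 + z * 2 + α =
        α + x * 2 + y * 2 + α * 2 ^ 2 + z * 2 ^ 2 + α * 2 ^ 2 →
      0 = α + x + y + α + z + α → x = -α ∧ y = -α ∧ z = -α := by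
    intro α x y z hp hq hs
    have hyz : y = z := by linear_combination hp / 2
    have hxz : x = z := by linear_combination hq / 2
    subst hyz hxz
    have : x = -α := by linear_combination -hs / 3
    exact ⟨this, this, this⟩
  simp only [h23, h13, h03, h12, h02] at s0 p0 q0 s1 p1 q1 s2 p2 q2 s3 p3 q3 s
  obtain ⟨x0, y0, z0⟩ := key _ _ _ _ p0 q0 s0
  obtain ⟨x1, y1, z1⟩ := key _ _ _ _ p1 q1 s1
  obtain ⟨x2, y2, z2⟩ := key _ _ _ _ p2 q2 (by linear_combination s2)
  obtain ⟨x3, y3, z3⟩ := key _ _ _ _ p3 q3 (by linear_combination s3)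
  rw [h23, h13, h03, h12, h02, x0, y0, z0, x1, y1, z1, x2, y2, z2, x3, y3, z3]
  rw [x0, y0, z0, x1, y1, z1, x2, y2, z2, x3, y3, z3] at s
  simp only [Pi.one_apply]
  linear_combination -(u 0 * u 1 * u 2 * u 3) * s

/-- A pair of partially expanded terms of the determinant of a `4 × 4` pencil: the sets of columns
used so far (as bit masks), the parity of the total sign and the degrees in the parameter. -/
structure PairState where
  maskL : ℕ
  maskR : ℕ
  neg : Bool
  degL : ℕ
  degR : ℕ

/-- Application of a function to the numeral that `n` evaluates to. -/
def forceNat {α : Type} (n : ℕ) (f : ℕ → α) : α :=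
  Nat.rec (motive := fun _ => α) (f 0) (fun k _ => f (Nat.succ k)) n

theorem forceNat_eq {α : Type} (n : ℕ) (f : ℕ → α) : forceNat n f = f n := by
  cases n <;> rfl

/-- Application of a function to the value of `b`. -/
def forceBool {α : Type} (b : Bool) (f : Bool → α) : α :=
  cond b (f true) (f false)

theorem forceBool_eq {α : Type} (b : Bool) (f : Bool → α) : forceBool b f = f b := by
  cases b <;> rfl

/-- Membership of `j` in the set with bit mask `m`. -/
def bitMem (m j : ℕ) : Bool := Nat.beq (Nat.land (Nat.shiftRight m j) 1) 1

/-- The parity of the number of columns in `m` to the right of `j`. -/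
def oddAbove (m j : ℕ) : Bool := bitMem 150 (Nat.shiftRight m (Nat.succ j))

/-- The effect on the states in `L` of choosing the columns `j` and `j'`. -/
def addColumns {α : Type} (j j' : ℕ) (L : List PairState) : (List PairState → α) → α :=
  List.rec (motive := fun _ => (List PairState → α) → α) (fun f => f [])
    (fun s _ ih f => PairState.casesOn s fun a b n d e =>
      cond (bitMem a j) (ih f) <| cond (bitMem b j') (ih f) <|
        forceNat (Nat.lor a (Nat.shiftLeft 1 j)) fun a' =>
        forceNat (Nat.lor b (Nat.shiftLeft 1 j')) fun b' =>
        forceBool (xor (oddAbove a j) (xor (oddAbove b j') n)) fun n' =>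
        ih fun t => f (⟨a', b', n', d, e⟩ :: t)) L

/-- The effect on the states in `L` of choosing the slices `k` and `k'`. -/
def addSlices {α : Type} (k k' : ℕ) (L : List PairState) (t : List PairState) :
    (List PairState → α) → α :=
  List.rec (motive := fun _ => (List PairState → α) → α) (fun f => f t)
    (fun s _ ih f => PairState.casesOn s fun a b n d e =>
      forceNat (Nat.add d k) fun d' =>
      forceNat (Nat.add e k') fun e' =>
      ih fun t => f (⟨a, b, n, d', e'⟩ :: t)) L

/-- The column indices of a product of two entries of a row, in increasing order. -/
def columnPairs : List (ℕ × ℕ) :=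
  [(0, 0), (0, 1), (0, 2), (0, 3), (1, 1), (1, 2), (1, 3), (2, 2), (2, 3), (3, 3)]

/-- The slice indices of a product of two entries in different columns. -/
def slicePairs : List (ℕ × ℕ) := [(0, 0), (0, 1), (1, 0), (1, 1)]

/-- The slice indices of a product of two entries in the same column. -/
def slicePairsDiag : List (ℕ × ℕ) := [(0, 0), (0, 1), (1, 1)]

/-- The pairing of `X ^ a` and `X ^ b`. -/
def pairingWeight (a b : ℕ) : ℤ :=
  match a, b with
  | 0, 4 => 12
  | 1, 3 => -3
  | 2, 2 => 2
  | 3, 1 => -3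
  | 4, 0 => 12
  | _, _ => 0

/-- The sum of the values of the states in `L` when all rows have been expanded. -/
def totalWeight (L : List PairState) : ℤ :=
  List.rec (motive := fun _ => ℤ) 0
    (fun s _ z => cond s.neg (z - pairingWeight s.degL s.degR) (z + pairingWeight s.degL s.degR)) L

/-- The combination under `op` of the images under `g` of all values obtained from the states in
`L` by expanding `n` further rows. -/
def foldLeaves {γ : Type} (op : γ → γ → γ) (e : γ) (g : ℤ → γ) (n : ℕ) : List PairState → γ :=
  Nat.rec (motive := fun _ => List PairState → γ)
    (fun L => g (totalWeight L))
    (fun _ ih L => columnPairs.foldr (fun c x => op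
      (forceNat c.1 fun j => forceNat c.2 fun j' =>
        addColumns j j' L fun M => addColumns j' j L fun M' =>
        cond (M.isEmpty && M'.isEmpty) e <|
        cond (Nat.beq j j')
          (slicePairsDiag.foldr (fun k y => op (addSlices k.1 k.2 M [] fun L' =>
            cond (Nat.beq k.1 k.2) (ih L') (addSlices k.2 k.1 M' L' ih)) y) e)
          (slicePairs.foldr (fun k y => op (addSlices k.1 k.2 M [] fun L' =>
            addSlices k.2 k.1 M' L' ih) y) e)) x) e) n

/-- Addition of the first and union of the second components, seen as bit masks. -/
def tallyAdd (x y : ℕ × ℕ) : ℕ × ℕ :=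
  Prod.casesOn x fun a m => Prod.casesOn y fun b n =>
    forceNat (Nat.add a b) fun c => forceNat (Nat.lor m n) fun o => (c, o)

/-- The contribution of a coefficient `z` to the number of nonzero coefficients and to the bit
mask of the nonzero coefficients. -/
def tally (z : ℤ) : ℕ × ℕ :=
  if z = 0 then (0, 0) else forceNat (Nat.shiftLeft 1 (z + 32).toNat) fun m => (1, m)

/-- The distinct nonzero coefficients. -/
def coeffValues : List ℤ := [-24, -16, -12, -6, -4, -2, 2, 4, 6, 8, 12, 18, 28]

theorem foldLeaves_tally : foldLeaves tallyAdd (0, 0) tally 4 [⟨0, 0, false, 0, 0⟩] =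
    (14148, (coeffValues.map fun z : ℤ => 2 ^ (z + 32).toNat).sum) := by
  decide +kernel

theorem bitMem_eq_testBit (m j : ℕ) : bitMem m j = m.testBit j := by
  have h : Nat.land (Nat.shiftRight m j) 1 = m >>> j % 2 := Nat.and_one_is_mod (m >>> j)
  rw [bitMem, h, Nat.testBit_eq_decide_div_mod_eq, Nat.shiftRight_eq_div_pow]
  exact Bool.eq_iff_iff.mpr (by simp)

/-- The state reached from `s` by choosing the columns `j₁` and `j₂`. -/
def PairState.withColumns (s : PairState) (j₁ j₂ : ℕ) : PairState :=
  ⟨s.maskL ||| 1 <<< j₁, s.maskR ||| 1 <<< j₂,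
    xor (oddAbove s.maskL j₁) (xor (oddAbove s.maskR j₂) s.neg), s.degL, s.degR⟩

/-- The state reached from `s` by choosing the slices `k₁` and `k₂`. -/
def PairState.withSlices (s : PairState) (k₁ k₂ : ℕ) : PairState :=
  ⟨s.maskL, s.maskR, s.neg, s.degL + k₁, s.degR + k₂⟩

/-- Whether the columns `j₁` and `j₂` are still available. -/
def PairState.accepts (s : PairState) (j₁ j₂ : ℕ) : Bool :=
  !bitMem s.maskL j₁ && !bitMem s.maskR j₂

/-- The states reached from `L` by choosing the columns `j₁` and `j₂`. -/
def columnStates (j₁ j₂ : ℕ) (L : List PairState) : List PairState :=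
  (L.filter fun s => s.accepts j₁ j₂).map fun s => s.withColumns j₁ j₂

/-- The states reached from `L` by choosing the entries `(j₁, k₁)` and `(j₂, k₂)` of a row, in
either order. -/
def rowStates (j₁ j₂ k₁ k₂ : ℕ) (L : List PairState) : List PairState :=
  if j₁ = j₂ ∧ k₁ = k₂ then (columnStates j₁ j₂ L).map fun s => s.withSlices k₁ k₂
  else (columnStates j₂ j₁ L).map (fun s => s.withSlices k₂ k₁) ++
    (columnStates j₁ j₂ L).map fun s => s.withSlices k₁ k₂

/-- The unordered pairs of entries of a row. -/
def rowPairs : List ((ℕ × ℕ) × ℕ × ℕ) :=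
  columnPairs.flatMap fun c =>
    (if c.1 = c.2 then slicePairsDiag else slicePairs).map fun k => (c, k)

theorem addColumns_eq {α : Type} (j j' : ℕ) (L : List PairState) (f : List PairState → α) :
    addColumns j j' L f = f (columnStates j j' L) := by
  induction L generalizing f with
  | nil => rfl
  | cons s L ih =>
    obtain ⟨a, b, n, d, e⟩ := s
    change (cond (bitMem a j) (addColumns j j' L f) <| cond (bitMem b j') (addColumns j j' L f) <|
      forceNat (Nat.lor a (Nat.shiftLeft 1 j)) fun a' =>
      forceNat (Nat.lor b (Nat.shiftLeft 1 j')) fun b' =>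
      forceBool (xor (oddAbove a j) (xor (oddAbove b j') n)) fun n' =>
      addColumns j j' L fun t => f (⟨a', b', n', d, e⟩ :: t)) = _
    simp only [ih, forceNat_eq, forceBool_eq]
    cases ha : bitMem a j
    · cases hb : bitMem b j'
      · simp [columnStates, PairState.accepts, ha, hb, PairState.withColumns]
      · simp [columnStates, PairState.accepts, hb]
    · simp [columnStates, PairState.accepts, ha]

theorem addSlices_eq {α : Type} (k k' : ℕ) (L t : List PairState) (f : List PairState → α) :
    addSlices k k' L t f = f ((L.map fun s => s.withSlices k k') ++ t) := by
  induction L generalizing f with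
  | nil => rfl
  | cons s L ih =>
    obtain ⟨a, b, n, d, e⟩ := s
    change (forceNat (Nat.add d k) fun d' => forceNat (Nat.add e k') fun e' =>
      addSlices k k' L t fun t => f (⟨a, b, n, d', e'⟩ :: t)) = _
    simp only [ih, forceNat_eq]
    rfl

/-- The values of all leaves below `L` after expanding `n` further rows. -/
def leafValues : ℕ → List PairState → List ℤ
  | 0, L => [totalWeight L]
  | n + 1, L => rowPairs.flatMap fun r => leafValues n (rowStates r.1.1 r.1.2 r.2.1 r.2.2 L)

theorem foldr_flatMap_of_assoc {α β γ : Type} {op : γ → γ → γ} {e : γ}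
    (hassoc : ∀ a b c, op (op a b) c = op a (op b c)) (he : ∀ a, op e a = a)
    (g : β → γ) (F : α → List β) (l : List α) :
    ((l.flatMap F).map g).foldr op e = l.foldr (fun a y => op (((F a).map g).foldr op e) y) e := by
  have happ : ∀ l l' : List γ, (l ++ l').foldr op e = op (l.foldr op e) (l'.foldr op e) := by
    intro l l'
    induction l with
    | nil => simp [he]
    | cons a l ih => simp [ih, hassoc]
  induction l with
  | nil => rfl
  | cons a l ih => simp only [List.flatMap_cons, List.map_append, happ, ih, List.foldr_cons]

theorem rowStates_nil (j j' k k' : ℕ) : rowStates j j' k k' [] = [] := by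
  simp [rowStates, columnStates]

theorem leafValues_nil (n : ℕ) : ∀ z ∈ leafValues n [], z = 0 := by
  induction n with
  | zero => simp [leafValues, totalWeight]
  | succ n ih =>
    intro z hz
    obtain ⟨r, -, hz⟩ := List.mem_flatMap.mp hz
    rw [rowStates_nil] at hz
    exact ih z hz

theorem foldLeaves_eq {γ : Type} {op : γ → γ → γ} {e : γ}
    (hassoc : ∀ a b c, op (op a b) c = op a (op b c)) (he : ∀ a, op e a = a)
    (he' : ∀ a, op a e = a) {g : ℤ → γ} (hg : g 0 = e) (n : ℕ) (L : List PairState) :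
    foldLeaves op e g n L = ((leafValues n L).map g).foldr op e := by
  induction n generalizing L with
  | zero => simp [leafValues, he', foldLeaves]
  | succ n ih =>
    have hzero : ∀ l : List ℤ, (∀ z ∈ l, z = 0) → (l.map g).foldr op e = e := by
      intro l hl
      induction l with
      | nil => rfl
      | cons z l ih =>
        rw [List.map_cons, List.foldr_cons, hl z (by simp), hg, he]
        exact ih fun z hz => hl z (by simp [hz])
    rw [leafValues, rowPairs, List.flatMap_assoc, foldr_flatMap_of_assoc hassoc he]
    change columnPairs.foldr (fun c x => op
      (forceNat c.1 fun j => forceNat c.2 fun j' =>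
        addColumns j j' L fun M => addColumns j' j L fun M' =>
        cond (M.isEmpty && M'.isEmpty) e <|
        cond (Nat.beq j j')
          (slicePairsDiag.foldr (fun k y => op (addSlices k.1 k.2 M [] fun L' =>
            cond (Nat.beq k.1 k.2) (foldLeaves op e g n L')
              (addSlices k.2 k.1 M' L' (foldLeaves op e g n))) y) e)
          (slicePairs.foldr (fun k y => op (addSlices k.1 k.2 M [] fun L' =>
            addSlices k.2 k.1 M' L' (foldLeaves op e g n)) y) e)) x) e = _
    congr 1
    funext ⟨j, j'⟩ x
    congr 1
    simp only [forceNat_eq, addColumns_eq, addSlices_eq, ih, List.append_nil]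
    rw [List.flatMap_map, foldr_flatMap_of_assoc hassoc he]
    cases hM : (columnStates j j' L).isEmpty && (columnStates j' j L).isEmpty
    · by_cases hj : j = j'
      · subst hj
        rw [cond_false, Nat.beq_refl, cond_true, if_pos rfl]
        congr 1
        funext ⟨k, k'⟩ y
        by_cases hk : k = k'
        · simp [rowStates, hk]
        · have : Nat.beq k k' = false := Bool.eq_false_iff.mpr fun h => hk (Nat.eq_of_beq_eq_true h)
          simp [rowStates, hk, this]
      · have : Nat.beq j j' = false := Bool.eq_false_iff.mpr fun h => hj (Nat.eq_of_beq_eq_true h)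
        simp [rowStates, hj, this]
    · simp only [Bool.and_eq_true, List.isEmpty_iff] at hM
      rw [cond_true]
      have hnil : ∀ k k', rowStates j j' k k' L = [] := by simp [rowStates, hM]
      simp only [hnil, hzero _ (leafValues_nil n)]
      generalize (if j = j' then slicePairsDiag else slicePairs) = l
      induction l with
      | nil => rfl
      | cons a l ihl => rw [List.foldr_cons, ← ihl, he]

theorem tallyAdd_mk (a m b n : ℕ) : tallyAdd (a, m) (b, n) = (a + b, m ||| n) := by
  simp only [tallyAdd, forceNat_eq]
  rfl

theorem foldr_tallyAdd_fst (l : List ℤ) :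
    ((l.map tally).foldr tallyAdd (0, 0)).1 = (l.filter fun z => z ≠ 0).length := by
  induction l with
  | nil => rfl
  | cons z l ih =>
    rw [List.map_cons, List.foldr_cons]
    generalize (l.map tally).foldr tallyAdd (0, 0) = p at ih
    obtain ⟨a, m⟩ := p
    dsimp only at ih
    subst ih
    by_cases hz : z = 0
    · simp [tally, hz, tallyAdd_mk]
    · simp [tally, hz, tallyAdd_mk, forceNat_eq, add_comm]

theorem testBit_foldr_tallyAdd_snd (l : List ℤ) (i : ℕ) :
    ((l.map tally).foldr tallyAdd (0, 0)).2.testBit i = true ↔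
      ∃ z ∈ l, z ≠ 0 ∧ (z + 32).toNat = i := by
  induction l with
  | nil => simp
  | cons z l ih =>
    rw [List.map_cons, List.foldr_cons]
    generalize (l.map tally).foldr tallyAdd (0, 0) = p at ih
    obtain ⟨a, m⟩ := p
    by_cases hz : z = 0
    · simp [tally, hz, tallyAdd_mk, ← ih]
    · have h1 : Nat.shiftLeft 1 (z + 32).toNat = 2 ^ (z + 32).toNat := Nat.one_shiftLeft _
      simp only [tally, hz, tallyAdd_mk, forceNat_eq, if_false, h1, Nat.testBit_or,
        Nat.testBit_two_pow, List.exists_mem_cons_iff, ← ih]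
      simp [hz]

theorem foldLeaves_tally_eq (n : ℕ) (L : List PairState) : foldLeaves tallyAdd (0, 0) tally n L =
    ((leafValues n L).map tally).foldr tallyAdd (0, 0) := by
  refine foldLeaves_eq (op := tallyAdd) (e := (0, 0)) (g := tally) ?_ ?_ ?_ rfl n L
  · rintro ⟨a, m⟩ ⟨b, n⟩ ⟨c, p⟩
    simp only [tallyAdd_mk, add_assoc, Nat.or_assoc]
  · rintro ⟨a, m⟩
    rw [tallyAdd_mk, zero_add, Nat.zero_or]
  · rintro ⟨a, m⟩
    rw [tallyAdd_mk, add_zero, Nat.or_zero]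

/-- The coefficients of the invariant, one for each choice of unordered pairs of entries in the
four rows. -/
def leafCoeffs : List ℤ := leafValues 4 [⟨0, 0, false, 0, 0⟩]

theorem length_filter_leafCoeffs : (leafCoeffs.filter fun z => z ≠ 0).length = 14148 := by
  rw [← foldr_tallyAdd_fst, leafCoeffs, ← foldLeaves_tally_eq, foldLeaves_tally]

theorem mem_coeffValues_iff (z : ℤ) : z ∈ coeffValues ↔ z ∈ leafCoeffs ∧ z ≠ 0 := by
  have key := testBit_foldr_tallyAdd_snd leafCoeffs
  rw [leafCoeffs, ← foldLeaves_tally_eq, foldLeaves_tally, ← leafCoeffs] at key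
  have hlt : ∀ i, 61 ≤ i →
      (coeffValues.map fun z : ℤ => 2 ^ (z + 32).toNat).sum.testBit i = false :=
    fun i hi => Nat.testBit_lt_two_pow (lt_of_lt_of_le (by decide)
      (Nat.pow_le_pow_right (n := 2) (by decide) hi))
  have hbits : ∀ i : ℕ, i < 61 →
      (coeffValues.map fun z : ℤ => 2 ^ (z + 32).toNat).sum.testBit i = true →
        0 < i ∧ (i : ℤ) - 32 ∈ coeffValues := by
    decide +kernel
  have hvalues : ∀ z ∈ coeffValues, z ≠ 0 ∧ 0 ≤ z + 32 ∧
      (coeffValues.map fun z : ℤ => 2 ^ (z + 32).toNat).sum.testBit (z + 32).toNat = true := by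
    decide +kernel
  have hleaf : ∀ z ∈ leafCoeffs, z ≠ 0 → 0 < z + 32 ∧ z ∈ coeffValues := by
    intro z hz hz0
    have hbit := (key _).mpr ⟨z, hz, hz0, rfl⟩
    obtain ⟨h1, h2⟩ := hbits _ (by_contra fun h => by simp [hlt _ (not_lt.mp h)] at hbit) hbit
    have h3 : ((z + 32).toNat : ℤ) = z + 32 := Int.toNat_of_nonneg (by omega)
    rw [h3, add_sub_cancel_right] at h2
    exact ⟨by omega, h2⟩
  refine ⟨fun hz => ?_, fun hz => (hleaf z hz.1 hz.2).2⟩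
  obtain ⟨hz0, hz1, hbit⟩ := hvalues z hz
  obtain ⟨z', hz', hz0', h⟩ := (key _).mp hbit
  have := (hleaf z' hz' hz0').1
  obtain rfl : z = z' := by omega
  exact ⟨hz', hz0⟩

/-- The variable in row `i`, column `j` and slice `k`. -/
def rowVar (i : Fin 4) (j k : ℕ) : Fin 4 × Fin 4 × Fin 2 := (i, Fin.ofNat 4 j, Fin.ofNat 2 k)

/-- The exponent vector of the product of a pair of entries of row `i`. -/
noncomputable def pairMonomial (i : Fin 4) (r : (ℕ × ℕ) × ℕ × ℕ) : Fin 4 × Fin 4 × Fin 2 →₀ ℕ :=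
  Finsupp.single (rowVar i r.1.1 r.2.1) 1 + Finsupp.single (rowVar i r.1.2 r.2.2) 1

/-- The exponent vectors and coefficients obtained from `L` by expanding the rows in `l`. -/
noncomputable def leafTerms :
    List (Fin 4) → List PairState → List ((Fin 4 × Fin 4 × Fin 2 →₀ ℕ) × ℤ)
  | [], L => [(0, totalWeight L)]
  | i :: l, L => rowPairs.flatMap fun r =>
      (leafTerms l (rowStates r.1.1 r.1.2 r.2.1 r.2.2 L)).map fun t => (pairMonomial i r + t.1, t.2)

theorem map_snd_leafTerms (l : List (Fin 4)) (L : List PairState) :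
    (leafTerms l L).map Prod.snd = leafValues l.length L := by
  induction l generalizing L with
  | nil => rfl
  | cons i l ih =>
    simp only [leafTerms, leafValues, List.length_cons, List.map_flatMap, List.map_map, ← ih]
    rfl

theorem pairMonomial_apply (i : Fin 4) (r : (ℕ × ℕ) × ℕ × ℕ) (j : Fin 4) (k : Fin 2) :
    pairMonomial i r (i, j, k) =
      (if Fin.ofNat 4 r.1.1 = j ∧ Fin.ofNat 2 r.2.1 = k then 1 else 0) +
        if Fin.ofNat 4 r.1.2 = j ∧ Fin.ofNat 2 r.2.2 = k then 1 else 0 := by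
  simp [pairMonomial, rowVar, Finsupp.single_apply]

theorem pairMonomial_apply_of_ne {i i' : Fin 4} (h : i' ≠ i) (r : (ℕ × ℕ) × ℕ × ℕ) (j : Fin 4)
    (k : Fin 2) : pairMonomial i r (i', j, k) = 0 := by
  simp [pairMonomial, rowVar, h]

theorem nodup_rowPairs : rowPairs.Nodup := by
  decide +kernel

theorem pairMonomial_injOn {i : Fin 4} {r r' : (ℕ × ℕ) × ℕ × ℕ} (hr : r ∈ rowPairs)
    (hr' : r' ∈ rowPairs) (h : ∀ j k, pairMonomial i r (i, j, k) = pairMonomial i r' (i, j, k)) :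
    r = r' := by
  simp only [pairMonomial_apply] at h
  have key : ∀ r ∈ rowPairs, ∀ r' ∈ rowPairs, (∀ (j : Fin 4) (k : Fin 2),
      ((if Fin.ofNat 4 r.1.1 = j ∧ Fin.ofNat 2 r.2.1 = k then 1 else 0) +
          if Fin.ofNat 4 r.1.2 = j ∧ Fin.ofNat 2 r.2.2 = k then 1 else 0) =
        (if Fin.ofNat 4 r'.1.1 = j ∧ Fin.ofNat 2 r'.2.1 = k then 1 else 0) +
          if Fin.ofNat 4 r'.1.2 = j ∧ Fin.ofNat 2 r'.2.2 = k then 1 else 0) → r = r' := by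
    decide +kernel
  exact key r hr r' hr' h

theorem leafTerms_apply_of_notMem {l : List (Fin 4)} {i : Fin 4} (hi : i ∉ l)
    {L : List PairState} {t : (Fin 4 × Fin 4 × Fin 2 →₀ ℕ) × ℤ} (ht : t ∈ leafTerms l L)
    (j : Fin 4) (k : Fin 2) : t.1 (i, j, k) = 0 := by
  induction l generalizing L t with
  | nil =>
    rw [List.mem_singleton.mp ht]
    rfl
  | cons i' l ih =>
    obtain ⟨r, -, ht⟩ := List.mem_flatMap.mp ht
    obtain ⟨t', ht', rfl⟩ := List.mem_map.mp ht
    rw [List.mem_cons, not_or] at hi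
    rw [Finsupp.add_apply, pairMonomial_apply_of_ne hi.1, ih hi.2 ht']

theorem nodup_map_fst_leafTerms {l : List (Fin 4)} (hl : l.Nodup) (L : List PairState) :
    ((leafTerms l L).map Prod.fst).Nodup := by
  induction l generalizing L with
  | nil => simp [leafTerms]
  | cons i l ih =>
    rw [List.nodup_cons] at hl
    rw [leafTerms, List.map_flatMap, List.nodup_flatMap]
    constructor
    · intro r _
      have := (ih hl.2 (rowStates r.1.1 r.1.2 r.2.1 r.2.2 L)).map
        (add_right_injective (pairMonomial i r))
      rw [List.map_map] at this ⊢
      exact this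
    · refine List.Pairwise.imp_of_mem (R := fun r r' => r ≠ r') (fun {r r'} hr hr' hne => ?_)
        nodup_rowPairs
      intro m hm hm'
      simp only [List.map_map, List.mem_map, Function.comp_apply] at hm hm'
      obtain ⟨t, ht, rfl⟩ := hm
      obtain ⟨t', ht', h⟩ := hm'
      refine hne (pairMonomial_injOn (i := i) hr hr' fun j k => ?_)
      have := DFunLike.congr_fun h (i, j, k)
      rw [Finsupp.add_apply, Finsupp.add_apply, leafTerms_apply_of_notMem hl.1 ht,
        leafTerms_apply_of_notMem hl.1 ht'] at this
      exact this.symm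

/-- The polynomial with the given list of exponent vectors and coefficients. -/
noncomputable def ofTerms {σ : Type*} (T : List ((σ →₀ ℕ) × ℤ)) : MvPolynomial σ ℂ :=
  (T.map fun t => monomial t.1 (t.2 : ℂ)).sum

theorem coeff_ofTerms_of_notMem {σ : Type*} {T : List ((σ →₀ ℕ) × ℤ)} {m : σ →₀ ℕ}
    (hm : m ∉ T.map Prod.fst) : coeff m (ofTerms T) = 0 := by
  classical
  induction T with
  | nil => simp [ofTerms]
  | cons t T ih =>
    rw [List.map_cons, List.mem_cons, not_or] at hm
    have := ih hm.2
    rw [ofTerms] at this ⊢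
    rw [List.map_cons, List.sum_cons, coeff_add, this, coeff_monomial, if_neg (Ne.symm hm.1),
      add_zero]

theorem coeff_ofTerms {σ : Type*} {T : List ((σ →₀ ℕ) × ℤ)} (hT : (T.map Prod.fst).Nodup)
    {t : (σ →₀ ℕ) × ℤ} (ht : t ∈ T) : coeff t.1 (ofTerms T) = t.2 := by
  classical
  induction T with
  | nil => simp at ht
  | cons s T ih =>
    rw [List.map_cons, List.nodup_cons] at hT
    have hcons : ofTerms (s :: T) = monomial s.1 (s.2 : ℂ) + ofTerms T := rfl
    rw [hcons, coeff_add, coeff_monomial]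
    obtain rfl | ht := List.mem_cons.mp ht
    · rw [if_pos rfl, coeff_ofTerms_of_notMem hT.1, add_zero]
    · rw [if_neg, zero_add, ih hT.2 ht]
      rintro h
      exact hT.1 (h ▸ List.mem_map_of_mem ht)

theorem support_C_mul_ofTerms {σ : Type*} [DecidableEq σ] {T : List ((σ →₀ ℕ) × ℤ)}
    (hT : (T.map Prod.fst).Nodup) {c : ℂ} (hc : c ≠ 0) :
    (C c * ofTerms T).support = ((T.filter fun t => t.2 ≠ 0).map Prod.fst).toFinset := by
  ext m
  rw [mem_support_iff, coeff_C_mul, List.mem_toFinset, List.mem_map]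
  constructor
  · intro h
    obtain ⟨t, ht, rfl⟩ := List.mem_map.mp (by_contra fun hm =>
      h (by rw [coeff_ofTerms_of_notMem hm, mul_zero]))
    refine ⟨t, List.mem_filter.mpr ⟨ht, ?_⟩, rfl⟩
    rw [coeff_ofTerms hT ht] at h
    simpa using right_ne_zero_of_mul h
  · rintro ⟨t, ht, rfl⟩
    rw [List.mem_filter] at ht
    rw [coeff_ofTerms hT ht.1]
    exact mul_ne_zero hc (by simpa using ht.2)

theorem card_support_C_mul_ofTerms {σ : Type*} {T : List ((σ →₀ ℕ) × ℤ)}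
    (hT : (T.map Prod.fst).Nodup) {c : ℂ} (hc : c ≠ 0) :
    (C c * ofTerms T).support.card = ((T.map Prod.snd).filter fun z => z ≠ 0).length := by
  classical
  rw [support_C_mul_ofTerms hT hc, List.toFinset_card_of_nodup, List.length_map, List.filter_map,
    List.length_map]
  · rfl
  · exact hT.sublist (List.filter_sublist.map _)

theorem image_coeff_C_mul_ofTerms {σ : Type*} {T : List ((σ →₀ ℕ) × ℤ)}
    (hT : (T.map Prod.fst).Nodup) {c : ℂ} (hc : c ≠ 0) :
    (C c * ofTerms T).support.image (fun m => coeff m (C c * ofTerms T)) =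
      ((T.map Prod.snd).toFinset.erase 0).image fun z : ℤ => c * z := by
  classical
  ext x
  rw [support_C_mul_ofTerms hT hc]
  simp only [Finset.mem_image, List.mem_toFinset, List.mem_map, List.mem_filter, coeff_C_mul,
    Finset.mem_erase]
  constructor
  · rintro ⟨_, ⟨t, ⟨ht, hz⟩, rfl⟩, rfl⟩
    exact ⟨t.2, ⟨by simpa using hz, t, ht, rfl⟩, by rw [coeff_ofTerms hT ht]⟩
  · rintro ⟨_, ⟨hz, t, ht, rfl⟩, rfl⟩
    exact ⟨t.1, ⟨t, ⟨ht, by simpa using hz⟩, rfl⟩, by rw [coeff_ofTerms hT ht]⟩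

/-- An integral multiple of the generator of the space of invariants of degree eight. -/
noncomputable def fundamentalInvariant : MvPolynomial (Fin 4 × Fin 4 × Fin 2) ℂ :=
  ofTerms (leafTerms [0, 1, 2, 3] [⟨0, 0, false, 0, 0⟩])

theorem card_support_C_mul_fundamentalInvariant {c : ℂ} (hc : c ≠ 0) :
    (C c * fundamentalInvariant).support.card = 14148 := by
  rw [fundamentalInvariant, card_support_C_mul_ofTerms (nodup_map_fst_leafTerms (by decide) _) hc,
    map_snd_leafTerms]
  exact length_filter_leafCoeffs

theorem card_image_coeff_C_mul_fundamentalInvariant {c : ℂ} (hc : c ≠ 0) :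
    ((C c * fundamentalInvariant).support.image
      fun m => coeff m (C c * fundamentalInvariant)).card = 13 := by
  rw [fundamentalInvariant, image_coeff_C_mul_ofTerms (nodup_map_fst_leafTerms (by decide) _) hc,
    map_snd_leafTerms, Finset.card_image_of_injective]
  · have : (leafValues [(0 : Fin 4), 1, 2, 3].length [⟨0, 0, false, 0, 0⟩]).toFinset.erase 0 =
        coeffValues.toFinset := by
      ext z
      rw [Finset.mem_erase, List.mem_toFinset, List.mem_toFinset, mem_coeffValues_iff, and_comm]
      rfl
    rw [this]
    decide
  · intro z z' h
    exact Int.cast_injective (mul_left_cancel₀ hc h)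

/-- The symmetric invariant bilinear form on binary quartic forms, up to scaling. -/
noncomputable def pairing : Polynomial ℂ →ₗ[ℂ] Polynomial ℂ →ₗ[ℂ] ℂ :=
  LinearMap.mk₂ ℂ (fun p q => 12 * (p.coeff 0 * q.coeff 4) - 3 * (p.coeff 1 * q.coeff 3)
      + 2 * (p.coeff 2 * q.coeff 2) - 3 * (p.coeff 3 * q.coeff 1) + 12 * (p.coeff 4 * q.coeff 0))
    (fun _ _ _ => by simp only [Polynomial.coeff_add]; ring)
    (fun _ _ _ => by simp only [Polynomial.coeff_smul, smul_eq_mul]; ring)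
    (fun _ _ _ => by simp only [Polynomial.coeff_add]; ring)
    (fun _ _ _ => by simp only [Polynomial.coeff_smul, smul_eq_mul]; ring)

theorem pairing_apply (p q : Polynomial ℂ) :
    pairing p q = 12 * (p.coeff 0 * q.coeff 4) - 3 * (p.coeff 1 * q.coeff 3)
      + 2 * (p.coeff 2 * q.coeff 2) - 3 * (p.coeff 3 * q.coeff 1)
      + 12 * (p.coeff 4 * q.coeff 0) := rfl

theorem pairing_X_pow (a b : ℕ) :
    pairing (Polynomial.X ^ a) (Polynomial.X ^ b) = pairingWeight a b := by
  rw [pairing_apply]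
  simp only [Polynomial.coeff_X_pow]
  rcases a with _ | _ | _ | _ | _ | a <;> rcases b with _ | _ | _ | _ | _ | b <;>
    simp [pairingWeight]

/-- The sign of the column `j` in a determinant expansion after the columns in `m` have been used,
and zero if `j` is one of these columns. -/
def columnSign (m j : ℕ) : ℂ := if bitMem m j then 0 else if oddAbove m j then -1 else 1

/-- The contribution of the rows in `l` to the determinant of the pencil with entries `v`, when the
columns in `m` have already been used. -/
noncomputable def partialDet (v : Fin 4 × Fin 4 × Fin 2 → ℂ) :
    List (Fin 4) → ℕ → Polynomial ℂ
  | [], _ => 1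
  | i :: l, m => ∑ j ∈ Finset.range 4, ∑ k ∈ Finset.range 2,
      (columnSign m j * v (rowVar i j k)) • (Polynomial.X ^ k * partialDet v l (m ||| 1 <<< j))

/-- The value of a state after expanding the rows in `l`. -/
noncomputable def stateValue (v : Fin 4 × Fin 4 × Fin 2 → ℂ) (l : List (Fin 4))
    (s : PairState) : ℂ :=
  (if s.neg then -1 else 1) * pairing (Polynomial.X ^ s.degL * partialDet v l s.maskL)
    (Polynomial.X ^ s.degR * partialDet v l s.maskR)

theorem sum_stateValue_nil (v : Fin 4 × Fin 4 × Fin 2 → ℂ) (L : List PairState) :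
    (L.map (stateValue v [])).sum = totalWeight L := by
  induction L with
  | nil => simp [totalWeight]
  | cons s L ih =>
    have hcons : totalWeight (s :: L) = cond s.neg (totalWeight L - pairingWeight s.degL s.degR)
      (totalWeight L + pairingWeight s.degL s.degR) := rfl
    rw [List.map_cons, List.sum_cons, ih, hcons, stateValue, partialDet, partialDet, mul_one,
      mul_one, pairing_X_pow]
    cases s.neg
    · simp [add_comm]
    · simp
      ring

theorem stateValue_cons (v : Fin 4 × Fin 4 × Fin 2 → ℂ) (i : Fin 4) (l : List (Fin 4))
    (s : PairState) :
    stateValue v (i :: l) s = ∑ j ∈ Finset.range 4, ∑ j' ∈ Finset.range 4,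
      ∑ k ∈ Finset.range 2, ∑ k' ∈ Finset.range 2, v (rowVar i j k) * v (rowVar i j' k') *
        if s.accepts j j' then stateValue v l ((s.withColumns j j').withSlices k k') else 0 := by
  have hmul : ∀ d m, Polynomial.X ^ d * partialDet v (i :: l) m = ∑ j ∈ Finset.range 4,
      ∑ k ∈ Finset.range 2, (columnSign m j * v (rowVar i j k)) •
        (Polynomial.X ^ (d + k) * partialDet v l (m ||| 1 <<< j)) := by
    intro d m
    simp only [partialDet, Finset.mul_sum, mul_smul_comm, pow_add, mul_assoc]
  simp only [stateValue, hmul, map_sum, LinearMap.sum_apply, map_smul, LinearMap.smul_apply,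
    Finset.mul_sum, smul_eq_mul]
  refine Eq.trans (Finset.sum_congr rfl fun j' _ => ?_) Finset.sum_comm
  rw [Finset.sum_comm]
  refine Finset.sum_congr rfl fun j _ => Eq.trans Finset.sum_comm ?_
  refine Finset.sum_congr rfl fun k _ => Finset.sum_congr rfl fun k' _ => ?_
  simp only [PairState.accepts, PairState.withColumns, PairState.withSlices, columnSign]
  generalize pairing _ _ = z
  by_cases hL : bitMem s.maskL j <;> by_cases hR : bitMem s.maskR j' <;>
    by_cases oL : oddAbove s.maskL j <;> by_cases oR : oddAbove s.maskR j' <;>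
    by_cases hn : s.neg <;> simp [hL, hR, oL, oR, hn, mul_assoc, mul_left_comm]

theorem sum_stateValue_cons (v : Fin 4 × Fin 4 × Fin 2 → ℂ) (i : Fin 4) (l : List (Fin 4))
    (L : List PairState) :
    (L.map (stateValue v (i :: l))).sum = ∑ j ∈ Finset.range 4, ∑ j' ∈ Finset.range 4,
      ∑ k ∈ Finset.range 2, ∑ k' ∈ Finset.range 2, v (rowVar i j k) * v (rowVar i j' k') *
        (((columnStates j j' L).map fun s => s.withSlices k k').map (stateValue v l)).sum := by
  induction L with
  | nil => simp [columnStates]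
  | cons s L ih =>
    rw [List.map_cons, List.sum_cons, ih, stateValue_cons]
    simp only [← Finset.sum_add_distrib, ← mul_add]
    refine Finset.sum_congr rfl fun j _ => Finset.sum_congr rfl fun j' _ =>
      Finset.sum_congr rfl fun k _ => Finset.sum_congr rfl fun k' _ => ?_
    cases h : s.accepts j j' <;> simp [columnStates, h]

theorem sum_rowPairs (x : ℕ → ℕ → ℂ) (T : ℕ → ℕ → ℕ → ℕ → ℂ) :
    (rowPairs.map fun r => x r.1.1 r.2.1 * x r.1.2 r.2.2 *
      if r.1.1 = r.1.2 ∧ r.2.1 = r.2.2 then T r.1.1 r.1.2 r.2.1 r.2.2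
      else T r.1.2 r.1.1 r.2.2 r.2.1 + T r.1.1 r.1.2 r.2.1 r.2.2).sum =
    ∑ j ∈ Finset.range 4, ∑ j' ∈ Finset.range 4, ∑ k ∈ Finset.range 2, ∑ k' ∈ Finset.range 2,
      x j k * x j' k' * T j j' k k' := by
  simp [rowPairs, columnPairs, slicePairs, slicePairsDiag, Finset.sum_range_succ]
  ring

theorem sum_map_flatMap {α β : Type*} (F : α → List β) (g : β → ℂ) (l : List α) :
    ((l.flatMap F).map g).sum = (l.map fun a => ((F a).map g).sum).sum := by
  induction l with
  | nil => rfl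
  | cons a l ih => simp [ih]

theorem eval_ofTerms_leafTerms (v : Fin 4 × Fin 4 × Fin 2 → ℂ) (l : List (Fin 4))
    (L : List PairState) :
    eval v (ofTerms (leafTerms l L)) = (L.map (stateValue v l)).sum := by
  have heval : ∀ T : List ((Fin 4 × Fin 4 × Fin 2 →₀ ℕ) × ℤ), eval v (ofTerms T) =
      (T.map fun t => eval v (monomial t.1 (t.2 : ℂ))).sum := by
    intro T
    rw [ofTerms, map_list_sum, List.map_map]
    rfl
  induction l generalizing L with
  | nil => simp [heval, leafTerms, sum_stateValue_nil, eval_monomial]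
  | cons i l ih =>
    have hpair : ∀ r, eval v (monomial (pairMonomial i r) 1) =
        v (rowVar i r.1.1 r.2.1) * v (rowVar i r.1.2 r.2.2) := by
      intro r
      rw [pairMonomial, ← mul_one (1 : ℂ), ← monomial_mul, map_mul]
      simp [eval_monomial]
    have hterm : ∀ (r : (ℕ × ℕ) × ℕ × ℕ) (t : (Fin 4 × Fin 4 × Fin 2 →₀ ℕ) × ℤ),
        eval v (monomial (pairMonomial i r + t.1) (t.2 : ℂ)) =
          v (rowVar i r.1.1 r.2.1) * v (rowVar i r.1.2 r.2.2) *
            eval v (monomial t.1 (t.2 : ℂ)) := by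
      intro r t
      rw [← hpair, ← map_mul, monomial_mul, one_mul]
    simp only [heval] at ih
    rw [heval, leafTerms, sum_map_flatMap]
    simp only [List.map_map, Function.comp_def, hterm, List.sum_map_mul_left]
    simp only [ih]
    rw [sum_stateValue_cons, ← sum_rowPairs]
    congr 2
    funext r
    rw [rowStates]
    split_ifs <;> simp

theorem eval_fundamentalInvariant (v : Fin 4 × Fin 4 × Fin 2 → ℂ) :
    eval v fundamentalInvariant =
      pairing (partialDet v [0, 1, 2, 3] 0) (partialDet v [0, 1, 2, 3] 0) := by
  rw [fundamentalInvariant, eval_ofTerms_leafTerms]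
  simp [stateValue]

theorem det_fin_four {R : Type*} [CommRing R] (A : Matrix (Fin 4) (Fin 4) R) : A.det =
    A 0 0 * (A 1 1 * (A 2 2 * A 3 3 - A 2 3 * A 3 2) - A 1 2 * (A 2 1 * A 3 3 - A 2 3 * A 3 1)
        + A 1 3 * (A 2 1 * A 3 2 - A 2 2 * A 3 1))
      - A 0 1 * (A 1 0 * (A 2 2 * A 3 3 - A 2 3 * A 3 2) - A 1 2 * (A 2 0 * A 3 3 - A 2 3 * A 3 0)
        + A 1 3 * (A 2 0 * A 3 2 - A 2 2 * A 3 0))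
      + A 0 2 * (A 1 0 * (A 2 1 * A 3 3 - A 2 3 * A 3 1) - A 1 1 * (A 2 0 * A 3 3 - A 2 3 * A 3 0)
        + A 1 3 * (A 2 0 * A 3 1 - A 2 1 * A 3 0))
      - A 0 3 * (A 1 0 * (A 2 1 * A 3 2 - A 2 2 * A 3 1) - A 1 1 * (A 2 0 * A 3 2 - A 2 2 * A 3 0)
        + A 1 2 * (A 2 0 * A 3 1 - A 2 1 * A 3 0)) := by
  rw [Matrix.det_succ_row_zero]
  simp only [Fin.sum_univ_four, Matrix.det_fin_three, Matrix.submatrix_apply]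
  simp [Fin.succAbove]
  ring

/-- The determinant of the matrix pencil `P + X * Q`. -/
noncomputable def pencilDet (P Q : Matrix (Fin 4) (Fin 4) ℂ) : Polynomial ℂ :=
  (P.map Polynomial.C + (Polynomial.X : Polynomial ℂ) • Q.map Polynomial.C).det

theorem partialDet_ofSlices (P Q : Matrix (Fin 4) (Fin 4) ℂ) :
    partialDet (ofSlices P Q) [0, 1, 2, 3] 0 = pencilDet P Q := by
  generalize hA : P.map Polynomial.C + (Polynomial.X : Polynomial ℂ) • Q.map Polynomial.C = A
  have hcons : ∀ i l m, partialDet (ofSlices P Q) (i :: l) m = ∑ j ∈ Finset.range 4,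
      columnSign m j • (A i (Fin.ofNat 4 j) * partialDet (ofSlices P Q) l (m ||| 1 <<< j)) := by
    intro i l m
    refine Finset.sum_congr rfl fun j _ => ?_
    simp [← hA, Finset.sum_range_succ, rowVar, ofSlices, Polynomial.smul_eq_C_mul]
    ring
  have hnil : ∀ m, partialDet (ofSlices P Q) [] m = 1 := fun _ => rfl
  rw [pencilDet, hA, det_fin_four]
  simp [hcons, hnil, Finset.sum_range_succ, columnSign, oddAbove, bitMem_eq_testBit, Nat.testBit,
    -Fin.ofNat_eq_cast]
  ring

theorem eval_ofSlices_fundamentalInvariant (P Q : Matrix (Fin 4) (Fin 4) ℂ) :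
    eval (ofSlices P Q) fundamentalInvariant = pairing (pencilDet P Q) (pencilDet P Q) := by
  rw [eval_fundamentalInvariant, partialDet_ofSlices]

theorem pencilDet_mul_left (g P Q : Matrix (Fin 4) (Fin 4) ℂ) :
    pencilDet (g * P) (g * Q) = g.det • pencilDet P Q := by
  have hC : g.det • pencilDet P Q = (g.map Polynomial.C).det * pencilDet P Q := by
    rw [Polynomial.smul_eq_C_mul, RingHom.map_det]
    rfl
  rw [hC, pencilDet, pencilDet, ← Matrix.det_mul, mul_add, Matrix.mul_smul, Matrix.map_mul,
    Matrix.map_mul]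

theorem pencilDet_mul_right (g P Q : Matrix (Fin 4) (Fin 4) ℂ) :
    pencilDet (P * g) (Q * g) = g.det • pencilDet P Q := by
  have hC : g.det • pencilDet P Q = pencilDet P Q * (g.map Polynomial.C).det := by
    rw [Polynomial.smul_eq_C_mul, RingHom.map_det, mul_comm]
    rfl
  rw [hC, pencilDet, pencilDet, ← Matrix.det_mul, add_mul, Matrix.smul_mul, Matrix.map_mul,
    Matrix.map_mul]

theorem eval_ofSlices_mul_left_fundamentalInvariant (g P Q : Matrix (Fin 4) (Fin 4) ℂ) :
    eval (ofSlices (g * P) (g * Q)) fundamentalInvariant =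
      g.det ^ 2 * eval (ofSlices P Q) fundamentalInvariant := by
  simp only [eval_ofSlices_fundamentalInvariant, pencilDet_mul_left, map_smul,
    LinearMap.smul_apply, smul_eq_mul]
  ring

theorem eval_ofSlices_mul_right_fundamentalInvariant (g P Q : Matrix (Fin 4) (Fin 4) ℂ) :
    eval (ofSlices (P * g) (Q * g)) fundamentalInvariant =
      g.det ^ 2 * eval (ofSlices P Q) fundamentalInvariant := by
  simp only [eval_ofSlices_fundamentalInvariant, pencilDet_mul_right, map_smul,
    LinearMap.smul_apply, smul_eq_mul]
  ring

theorem pencilDet_one_of_upperTriangular {U : Matrix (Fin 4) (Fin 4) ℂ}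
    (hU : U.BlockTriangular id) :
    pencilDet 1 U = ∏ i, (1 + Polynomial.X * Polynomial.C (U i i)) := by
  rw [pencilDet, Matrix.det_of_isUpperTriangular]
  · simp
  · intro i j hij
    have hne : i ≠ j := fun h => hij.ne' (congrArg id h)
    simp [hne, hU hij]

theorem eval_ofSlices_one_fundamentalInvariant {U : Matrix (Fin 4) (Fin 4) ℂ}
    (hU : U.BlockTriangular id) :
    eval (ofSlices 1 U) fundamentalInvariant = 2 *
      ((U 0 0 ^ 2 * U 1 1 ^ 2 + U 0 0 ^ 2 * U 2 2 ^ 2 + U 0 0 ^ 2 * U 3 3 ^ 2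
          + U 1 1 ^ 2 * U 2 2 ^ 2 + U 1 1 ^ 2 * U 3 3 ^ 2 + U 2 2 ^ 2 * U 3 3 ^ 2)
        - U 0 0 * U 1 1 * U 2 2 * (U 0 0 + U 1 1 + U 2 2)
        - U 0 0 * U 1 1 * U 3 3 * (U 0 0 + U 1 1 + U 3 3)
        - U 0 0 * U 2 2 * U 3 3 * (U 0 0 + U 2 2 + U 3 3)
        - U 1 1 * U 2 2 * U 3 3 * (U 1 1 + U 2 2 + U 3 3)
        + 6 * (U 0 0 * U 1 1 * U 2 2 * U 3 3)) := by
  have hexpand : ∀ a b c d : ℂ, (1 + Polynomial.X * Polynomial.C a) *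
      (1 + Polynomial.X * Polynomial.C b) * (1 + Polynomial.X * Polynomial.C c) *
      (1 + Polynomial.X * Polynomial.C d) = Polynomial.C 1
        + Polynomial.C (a + b + c + d) * Polynomial.X ^ 1
        + Polynomial.C (a * b + a * c + a * d + b * c + b * d + c * d) * Polynomial.X ^ 2
        + Polynomial.C (a * b * c + a * b * d + a * c * d + b * c * d) * Polynomial.X ^ 3
        + Polynomial.C (a * b * c * d) * Polynomial.X ^ 4 := by
    intro a b c d
    simp only [map_add, map_mul, map_one]
    ring
  rw [eval_ofSlices_fundamentalInvariant, pencilDet_one_of_upperTriangular hU, Fin.prod_univ_four,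
    hexpand, pairing_apply]
  simp only [Polynomial.coeff_add, Polynomial.coeff_C_mul, Polynomial.coeff_X_pow,
    Polynomial.coeff_C]
  norm_num
  ring

theorem InvariantPoly.eval_ofSlices_one {f : MvPolynomial (Fin 4 × Fin 4 × Fin 2) ℂ}
    (hf : InvariantPoly f) (hhom : f.IsHomogeneous 8) {U : Matrix (Fin 4) (Fin 4) ℂ}
    (hU : U.BlockTriangular id) :
    eval (ofSlices 1 U) f =
      eval (ofSlices 1 U)
        (C (coeff (diagMonomial ![2, 2, 0, 0]) f / 2) * fundamentalInvariant) := by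
  have hdiag : eval (ofSlices 1 U) f = eval (ofSlices 1 (Matrix.diagonal fun i => U i i)) f := by
    rw [hf.eval_ofSlices_of_upperTriangular hhom Matrix.blockTriangular_one hU,
      hf.eval_ofSlices_of_upperTriangular hhom Matrix.blockTriangular_one
        (Matrix.blockTriangular_diagonal _)]
    simp only [Matrix.diagonal_apply_eq]
  rw [hdiag, hf.eval_ofSlices_one_diagonal hhom, map_mul, eval_C,
    eval_ofSlices_one_fundamentalInvariant hU]
  ring

theorem InvariantPoly.eval_ofSlices_of_det_ne_zero {f : MvPolynomial (Fin 4 × Fin 4 × Fin 2) ℂ}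
    (hf : InvariantPoly f) (hhom : f.IsHomogeneous 8) {A : Matrix (Fin 4) (Fin 4) ℂ}
    (hA : A.det ≠ 0) (B : Matrix (Fin 4) (Fin 4) ℂ) :
    eval (ofSlices A B) f =
      eval (ofSlices A B)
        (C (coeff (diagMonomial ![2, 2, 0, 0]) f / 2) * fundamentalInvariant) := by
  obtain ⟨P, U, hP, hPU, hU⟩ := exists_mul_eq_mul_blockTriangular (A⁻¹ * B)
  have hPu : IsUnit P.det := hP.isUnit
  have hAP : (A * P).det ≠ 0 := by
    rw [Matrix.det_mul]
    exact mul_ne_zero hA hP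
  have hPinv : P⁻¹.det ≠ 0 := by
    rw [Matrix.det_nonsing_inv]
    exact hPu.ringInverse.ne_zero
  have hA' : A = A * P * 1 * P⁻¹ := by
    rw [mul_one, Matrix.mul_nonsing_inv_cancel_right _ _ hPu]
  have hB' : B = A * P * U * P⁻¹ := by
    rw [mul_assoc A P U, ← hPU, ← mul_assoc, Matrix.mul_nonsing_inv_cancel_right _ _ hPu,
      Matrix.mul_nonsing_inv_cancel_left _ _ hA.isUnit]
  rw [map_mul, hA', hB', hf.eval_ofSlices_mul_right hhom hPinv,
    hf.eval_ofSlices_mul_left hhom hAP, hf.eval_ofSlices_one hhom hU, map_mul,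
    eval_ofSlices_mul_right_fundamentalInvariant, eval_ofSlices_mul_left_fundamentalInvariant,
    eval_C, eval_C]
  ring

/-- The space of invariants of degree eight is spanned by `fundamentalInvariant`. -/
theorem InvariantPoly.eq_C_mul_fundamentalInvariant {f : MvPolynomial (Fin 4 × Fin 4 × Fin 2) ℂ}
    (hf : InvariantPoly f) (hhom : f.IsHomogeneous 8) :
    f = C (coeff (diagMonomial ![2, 2, 0, 0]) f / 2) * fundamentalInvariant := by
  let D : MvPolynomial (Fin 4 × Fin 4 × Fin 2) ℂ :=
    (Matrix.of fun i j => X (i, j, 0) : Matrix (Fin 4) (Fin 4) _).det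
  have hD : ∀ P Q, eval (ofSlices P Q) D = P.det := by
    intro P Q
    rw [RingHom.map_det]
    congr 1
    ext i j
    simp [ofSlices]
  have hD0 : D ≠ 0 := by
    intro h
    have := hD 1 0
    simp [h] at this
  have hmul :
      D * (f - C (coeff (diagMonomial ![2, 2, 0, 0]) f / 2) * fundamentalInvariant) = 0 := by
    refine MvPolynomial.funext fun x => ?_
    obtain ⟨P, Q, rfl⟩ := ofSlices_surjective x
    rw [map_mul, hD, map_sub, map_zero]
    by_cases h : P.det = 0
    · rw [h, zero_mul]
    · rw [hf.eval_ofSlices_of_det_ne_zero hhom h, sub_self, mul_zero]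
  exact sub_eq_zero.mp ((mul_eq_zero.mp hmul).resolve_left hD0)

/-- Theorem 16 (explicit form): every nonzero invariant homogeneous polynomial of degree 8
for `4 × 4 × 2` arrays has exactly 14148 monomials and exactly 13 distinct nonzero
coefficients. -/
theorem invariant_degree_eight_support_and_coeffs
    (f : MvPolynomial (Fin 4 × Fin 4 × Fin 2) ℂ) (hf : f ≠ 0)
    (hhom : f.IsHomogeneous 8) (hinv : InvariantPoly f) :
    f.support.card = 14148 ∧ (f.support.image fun m => f.coeff m).card = 13 := by
  have key := hinv.eq_C_mul_fundamentalInvariant hhom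
  have hc : coeff (diagMonomial ![2, 2, 0, 0]) f / 2 ≠ 0 := fun h =>
    hf (by rw [key, h, C_0, zero_mul])
  generalize coeff (diagMonomial ![2, 2, 0, 0]) f / 2 = c at key hc
  rw [key]
  exact ⟨card_support_C_mul_fundamentalInvariant hc,
    card_image_coeff_C_mul_fundamentalInvariant hc⟩
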